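/- (Fueter–Sce theorem for generalized partial-slice monogenic functions) Let f(𝐱) = F₁(𝐱') + ωF₂(𝐱') ∈ 𝒢𝒮ℛ(Ω_D) and let q be odd. Then the function τ_q f(𝐱) := (1/(q−1)!!) Δ_𝐱^{(q−1)/2} f(𝐱) = A(𝐱') + ω B(𝐱'), where A = ((1/r)∂_r)^{(q−1)/2} F₁ and B = (∂_r(1/r))^{(q−1)/2} F₂ (values at r = 0 taken as limits), is monogenic in Ω_D. In particular τ_q maps 𝒢𝒮ℛ(Ω_D) into the class 𝒜ℳ(Ω_D) = ℳ(Ω_D) ∩ 𝒢𝒮(Ω_D) of axially monogenic functions. -/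

import Mathlib

/-!
Common framework for generalized partial-slice monogenic functions
(Xu–Sabadini, "On the Fueter-Sce theorem for generalized partial-slice
monogenic functions").

The real Clifford algebra `ℝ_{p+q}` is formalized as the Mathlib Clifford
algebra of the negative-definite quadratic form on `ℝ^{p+q}`; since Mathlib
provides no canonical norm on it, all analytic statements are phrased for an
arbitrary normed real algebra `A` together with an `ℝ`-algebra isomorphism
`ξ : A ≃ₐ[ℝ] Cl (p+q)`.  A point of `ℝ^{p+q+1}` is a pair
`(𝐱_p, 𝐱_q) : (Fin (p+1) → ℝ) × EuclideanSpace ℝ (Fin q)`, and a point of a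
slice `ℝ^{p+2}` is a pair `(𝐱_p, r)`.
-/

noncomputable section

open Filter Topology MeasureTheory Metric
open scoped Nat RealInnerProductSpace

namespace GPS

/-- The negative definite quadratic form `-(x₁² + ⋯ + xₙ²)` on `ℝⁿ`. -/
def Qe (n : ℕ) : QuadraticForm ℝ (Fin n → ℝ) :=
  QuadraticMap.weightedSumSquares ℝ (fun _ : Fin n => (-1 : ℝ))

/-- The real Clifford algebra `ℝ_n`. -/
abbrev Cl (n : ℕ) : Type := CliffordAlgebra (Qe n)

/-- The generators `e_1, …, e_n` of `ℝ_n` (indexed by `Fin n`). -/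
def e (n : ℕ) (i : Fin n) : Cl n := CliffordAlgebra.ι (Qe n) (Pi.single i 1)

variable (p q : ℕ)

/-- `ℝ^{p+1}`, the "slice-axis" space. -/
abbrev Vp : Type := Fin (p + 1) → ℝ

/-- `ℝ^q`. -/
abbrev Vq : Type := EuclideanSpace ℝ (Fin q)

/-- `ℝ^{p+q+1} = ℝ^{p+1} ⊕ ℝ^q`. -/
abbrev V : Type := Vp p × Vq q

/-- `ℝ^{p+2}`, the parameter space `(𝐱_p, r)` of a slice. -/
abbrev Sl : Type := Vp p × ℝ

/-- The sphere `𝕊` of unit 1-vectors, described by their coordinate vectors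
`(x_{p+1}, …, x_{p+q}) ∈ ℝ^q` with `∑ x_i² = 1`. -/
def S : Set (Vq q) := {v | ∑ j, v j ^ 2 = 1}

/-- The point `𝐱_p + r ω` of `ℝ^{p+q+1}`. -/
def spt (v : Vq q) (z : Sl p) : V p q := (z.1, z.2 • v)

/-- The (parameterized) slice `Ω_ω` of a set `Ω ⊆ ℝ^{p+q+1}`. -/
def sliceSet (Ω : Set (V p q)) (v : Vq q) : Set (Sl p) := {z | spt p q v z ∈ Ω}

/-- `Ω₀* = {𝐱_p + 𝐱_q : 𝐱_p ∈ Ω₀, 𝐱_q ∈ ℝ^q}`. -/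
def star0 (Ω₀ : Set (Vp p)) : Set (V p q) := {z | z.1 ∈ Ω₀}

/-- The p-symmetric completion `Ω_D` of a set `D ⊆ ℝ^{p+2}`. -/
def completion (D : Set (Sl p)) : Set (V p q) :=
  {x | ∃ z ∈ D, ∃ v ∈ S q, x = spt p q v z}

/-- `D` is invariant under the reflection of the `(p+2)`-th variable. -/
def ReflInv (D : Set (Sl p)) : Prop := ∀ z ∈ D, ((z.1, -z.2) : Sl p) ∈ D

/-- A domain: a nonempty open connected set. -/
def IsDomain {E : Type*} [TopologicalSpace E] (s : Set E) : Prop :=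
  IsOpen s ∧ IsConnected s

/-- A slice domain. -/
def IsSliceDomain (Ω : Set (V p q)) : Prop :=
  IsDomain Ω ∧ (∃ x : Vp p, ((x, 0) : V p q) ∈ Ω) ∧
    ∀ v ∈ S q, IsDomain (sliceSet p q Ω v)

/-- Partial symmetry with respect to `ℝ^{p+1}`. -/
def IsPSymmetric (Ω : Set (V p q)) : Prop :=
  ∀ (x : Vp p) (r : ℝ), ∀ v ∈ S q, ∀ w ∈ S q,
    ((x, r • v) : V p q) ∈ Ω → ((x, r • w) : V p q) ∈ Ω

/-- A `d`-dimensional smooth submanifold of a real normed space. -/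
def IsSmoothSubmanifoldDim {E : Type*} [NormedAddCommGroup E] [NormedSpace ℝ E]
    (d : ℕ) (M : Set E) : Prop :=
  ∀ x ∈ M, ∃ U : Set E, IsOpen U ∧ x ∈ U ∧
    ∃ (ψ : (Fin d → ℝ) → E) (W : Set (Fin d → ℝ)), IsOpen W ∧
      ContDiffOn ℝ (⊤ : ℕ∞) ψ W ∧ Set.InjOn ψ W ∧
      (∀ y ∈ W, Function.Injective (fderivWithin ℝ ψ W y)) ∧
      M ∩ U = ψ '' W

variable {A : Type*} [NormedRing A] [NormedAlgebra ℝ A] (ξ : A ≃ₐ[ℝ] Cl (p + q))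

/-- The generators `e_1, …, e_{p+q}` inside `A`. -/
def gen (i : Fin (p + q)) : A := ξ.symm (e (p + q) i)

/-- The generators `e_{p+1}, …, e_{p+q}` (the "q-part"). -/
def eQ (j : Fin q) : A := gen p q ξ ⟨p + (j : ℕ), by have := j.isLt; omega⟩

/-- The generators `e_1, …, e_p` (the "p-part", without `e_0 = 1`). -/
def eP (i : Fin p) : A := gen p q ξ ⟨(i : ℕ), by have := i.isLt; omega⟩

/-- `e_0 = 1, e_1, …, e_p`: the paravector basis of `ℝ^{p+1}` inside `A`. -/
def εp (i : Fin (p + 1)) : A :=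
  if h : (i : ℕ) = 0 then 1 else gen p q ξ ⟨(i : ℕ) - 1, by have := i.isLt; omega⟩

/-- The 1-vector `∑ x_i e_{p+i} ∈ A` corresponding to `𝐱_q ∈ ℝ^q`;
for a unit `v` this is the imaginary unit `ω ∈ 𝕊`. -/
def ωCl (v : Vq q) : A := ∑ j, v j • eQ p q ξ j

/-- The paravector `x_0 + x_1 e_1 + ⋯ + x_p e_p ∈ A` of `𝐱_p ∈ ℝ^{p+1}`. -/
def clP (x : Vp p) : A := ∑ i, x i • εp p q ξ i

/-- The paravector of `𝐱 ∈ ℝ^{p+q+1}` in `A`. -/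
def toCl (z : V p q) : A := clP p q ξ z.1 + ωCl p q ξ z.2

section SliceOperators

variable {F' : Type*} [NormedAddCommGroup F'] [NormedSpace ℝ F']

/-- `∂_{x_i}` on functions on `ℝ^{p+2}`. -/
def pdSl (i : Fin (p + 1)) (F : Sl p → F') : Sl p → F' :=
  fun z => fderiv ℝ F z (Pi.single i 1, 0)

/-- `∂_r` on functions on `ℝ^{p+2}`. -/
def pdr (F : Sl p → F') : Sl p → F' := fun z => fderiv ℝ F z (0, 1)

/-- `∂_{x_i}` (first factor) on functions on `ℝ^{p+q+1}`. -/
def pdV1 (i : Fin (p + 1)) (f : V p q → F') : V p q → F' :=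
  fun z => fderiv ℝ f z ((Pi.single i 1 : Vp p), 0)

/-- `∂_{x_{p+j}}` (second factor) on functions on `ℝ^{p+q+1}`. -/
def pdV2 (j : Fin q) (f : V p q → F') : V p q → F' :=
  fun z => fderiv ℝ f z (0, EuclideanSpace.single j 1)

/-- `∂_{x_i}` on functions on `ℝ^{p+1}`. -/
def pdP (i : Fin (p + 1)) (g : Vp p → F') : Vp p → F' :=
  fun x => fderiv ℝ g x (Pi.single i 1)

/-- The Laplacian `Δ_{𝐱'} = Δ_{𝐱_p} + ∂_r²` on `ℝ^{p+2}`. -/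
def LapSl (F : Sl p → F') : Sl p → F' :=
  fun z => ∑ i, pdSl p (i := i) (pdSl p i F) z + pdr p (pdr p F) z

/-- The Laplacian `Δ_𝐱` on `ℝ^{p+q+1}`. -/
def LapV (f : V p q → F') : V p q → F' :=
  fun z => ∑ i, pdV1 p q i (pdV1 p q i f) z + ∑ j, pdV2 p q j (pdV2 p q j f) z

/-- The Laplacian `Δ_{𝐱_p}` on `ℝ^{p+1}`. -/
def LapP (g : Vp p → F') : Vp p → F' :=
  fun x => ∑ i, pdP p i (pdP p i g) x

end SliceOperators

/-- The generalized Cauchy–Riemann operator `D_{𝐱_p} = ∑_{i=0}^p e_i ∂_{x_i}`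
on slice functions. -/
def DP (F : Sl p → A) : Sl p → A :=
  fun z => ∑ i, εp p q ξ i * pdSl p i F z

/-- The conjugated operator `D̄_{𝐱_p} = ∂_{x_0} - ∑_{i=1}^p e_i ∂_{x_i}`. -/
def DPbar (F : Sl p → A) : Sl p → A :=
  fun z => pdSl p 0 F z - ∑ i : Fin p, eP p q ξ i * pdSl p i.succ F z

/-- The generalized Cauchy–Riemann (Dirac) operator `D_𝐱` on `ℝ^{p+q+1}`. -/
def DV (f : V p q → A) : V p q → A :=
  fun z => ∑ i, εp p q ξ i * pdV1 p q i f z + ∑ j, eQ p q ξ j * pdV2 p q j f z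

/-- `D_{𝐱_p} = ∑_{i=0}^p e_i ∂_{x_i}` on functions on `ℝ^{p+1}`. -/
def DPfun (g : Vp p → A) : Vp p → A :=
  fun x => ∑ i, εp p q ξ i * pdP p i g x

/-- The slice operator `D_ω = D_{𝐱_p} + ω ∂_r`, expressed on `ℝ^{p+q+1} ∖ ℝ^{p+1}`
(at `𝐱_q = 0` the radial part is junk `0`). -/
def Dslice (f : V p q → A) : V p q → A :=
  fun z => ∑ i, εp p q ξ i * pdV1 p q i f z
    + ωCl p q ξ (‖z.2‖⁻¹ • z.2) * fderiv ℝ f z (0, ‖z.2‖⁻¹ • z.2)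

/-- The spherical Dirac operator `Γ = -∑_{i<j} e_i e_j L_{ij}` on the `ℝ^q` variables. -/
def sphericalDirac (f : V p q → A) : V p q → A :=
  fun z => - ∑ i : Fin q, ∑ j : Fin q,
    if (i : ℕ) < (j : ℕ) then
      eQ p q ξ i * eQ p q ξ j *
        (z.2 i • pdV2 p q j f z - z.2 j • pdV2 p q i f z)
    else 0

/-- `f` is left generalized partial-slice monogenic of type `(p,q)` on `Ω`. -/
def GSMOn (Ω : Set (V p q)) (f : V p q → A) : Prop :=
  ∀ v ∈ S q,
    ContDiffOn ℝ 1 (fun z => f (spt p q v z)) (sliceSet p q Ω v) ∧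
    ∀ z ∈ sliceSet p q Ω v,
      DP p q ξ (fun w => f (spt p q v w)) z
        + ωCl p q ξ v * pdr p (fun w => f (spt p q v w)) z = 0

/-- `f` is (left) monogenic on `Ω`. -/
def MonogenicOn (Ω : Set (V p q)) (f : V p q → A) : Prop :=
  ContDiffOn ℝ 1 f Ω ∧ ∀ z ∈ Ω, DV p q ξ f z = 0

/-- `f` is the generalized partial-slice function on `Ω_D` with components `F1, F2`
(an even–odd pair in the last variable). -/
def IsGPSlice (D : Set (Sl p)) (f : V p q → A) (F1 F2 : Sl p → A) : Prop :=
  (∀ z ∈ D, F1 (z.1, -z.2) = F1 z ∧ F2 (z.1, -z.2) = -F2 z) ∧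
  ∀ z ∈ D, ∀ v ∈ S q, f (spt p q v z) = F1 z + ωCl p q ξ v * F2 z

/-- The generalized Cauchy–Riemann system (2.6) for the pair `(F1, F2)`. -/
def CRSystem (D : Set (Sl p)) (F1 F2 : Sl p → A) : Prop :=
  ∀ z ∈ D, DP p q ξ F1 z - pdr p F2 z = 0 ∧ DPbar p q ξ F2 z + pdr p F1 z = 0

/-- `f ∈ 𝒢𝒮ℛ(Ω_D)` with the given components. -/
def GSROnWith (D : Set (Sl p)) (f : V p q → A) (F1 F2 : Sl p → A) : Prop :=
  IsGPSlice p q ξ D f F1 F2 ∧ ContDiffOn ℝ 1 F1 D ∧ ContDiffOn ℝ 1 F2 D ∧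
    CRSystem p q ξ D F1 F2

/-- `f ∈ 𝒢𝒮ℛ(Ω_D)`. -/
def GSROn (D : Set (Sl p)) (f : V p q → A) : Prop :=
  ∃ F1 F2, GSROnWith p q ξ D f F1 F2

/-- Iterates `((1/r) ∂_r)^k F`. -/
def AIter (F : Sl p → A) : ℕ → Sl p → A
  | 0 => F
  | k + 1 => fun z => z.2⁻¹ • pdr p (AIter F k) z

/-- Iterates `(∂_r (1/r))^k F`. -/
def BIter (F : Sl p → A) : ℕ → Sl p → A
  | 0 => F
  | k + 1 => fun z => fderiv ℝ (fun w : Sl p => w.2⁻¹ • BIter F k w) z (0, 1)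

/-- `C_q(k) = (q-1)(q-3)⋯(q-2k+1)`. -/
def Cq (k : ℕ) : ℝ := ∏ j ∈ Finset.range k, ((q : ℝ) - (2 * (j : ℝ) + 1))

/-- The Fueter–Sce map `τ_q = (1/(q-1)!!) Δ^{(q-1)/2}` (for odd `q`). -/
def tauq (f : V p q → A) : V p q → A :=
  fun z => (((q - 1)‼ : ℝ))⁻¹ • (LapV p q)^[(q - 1) / 2] f z

/-- `(𝐱_q D_{𝐱_p})^k`, for a fixed Clifford element `u` in place of `𝐱_q`. -/
def uDpow (u : A) : ℕ → (Vp p → A) → Vp p → A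
  | 0 => fun g => g
  | k + 1 => fun g x => u * DPfun p q ξ (uDpow u k g) x

/-- The `k`-th term of the slice Cauchy–Kovalevskaya extension series. -/
def ckTerm (f₀ : Vp p → A) (k : ℕ) (z : V p q) : A :=
  ((k ! : ℝ))⁻¹ • uDpow p q ξ (ωCl p q ξ z.2) k f₀ z.1

/-- The slice Cauchy–Kovalevskaya extension `CK[f₀]`. -/
def CKext (f₀ : Vp p → A) (z : V p q) : A := ∑' k, ckTerm p q ξ f₀ k z

/-- The `k`-th term of the CK-extension for a fixed direction `w`. -/
def ckDirTerm (w : Vq q) (f₀ : Vp p → A) (k : ℕ) (z : V p q) : A :=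
  ((⟪w, z.2⟫) ^ k / (k ! : ℝ)) • uDpow p q ξ (ωCl p q ξ w) k f₀ z.1

/-- The CK-extension for a fixed direction `w ∈ 𝕊`. -/
def CKdir (w : Vq q) (f₀ : Vp p → A) (z : V p q) : A :=
  ∑' k, ckDirTerm p q ξ w f₀ k z

/-- The coefficients of the generalized CK-extension:
`f_{2k} = (Γ(q/2) / (2^{2k} k! Γ(k+q/2))) Δ^k f₀` and
`f_{2k+1} = (Γ(q/2) / (2^{2k+1} k! Γ(k+q/2+1))) D Δ^k f₀`. -/
def gckCoeff (f₀ : Vp p → A) (k : ℕ) : Vp p → A :=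
  if k % 2 = 0 then
    fun x => (Real.Gamma ((q : ℝ) / 2) /
        (2 ^ k * ((k / 2)! : ℝ) * Real.Gamma (((k / 2 : ℕ) : ℝ) + (q : ℝ) / 2))) •
      (LapP p)^[k / 2] f₀ x
  else
    fun x => (Real.Gamma ((q : ℝ) / 2) /
        (2 ^ k * ((k / 2)! : ℝ) * Real.Gamma (((k / 2 : ℕ) : ℝ) + (q : ℝ) / 2 + 1))) •
      DPfun p q ξ ((LapP p)^[k / 2] f₀) x

/-- The `k`-th term `𝐱_q^k f_k(𝐱_p)` of the generalized CK-extension series. -/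
def gckTerm (f₀ : Vp p → A) (k : ℕ) (z : V p q) : A :=
  (ωCl p q ξ z.2) ^ k * gckCoeff p q ξ f₀ k z.1

/-- The generalized CK-extension `GCK[f₀]`. -/
def GCKext (f₀ : Vp p → A) (z : V p q) : A := ∑' k, gckTerm p q ξ f₀ k z

/-- The Radon transform `R[f](𝐱_p, r, ω) = ∫_{⟨𝐱_q,ω⟩=r} f(𝐱_p, 𝐱_q) dσ(𝐱_q)`. -/
def radon (f : V p q → A) (x : Vp p) (r : ℝ) (w : Vq q) : A :=
  ∫ u : ((Submodule.span ℝ {w})ᗮ : Submodule ℝ (Vq q)),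
    f (x, r • w + (u : Vq q))

/-- The (suitably normalized) surface measure on the unit sphere of `ℝ^q`. -/
def sphMeasure : Measure (sphere (0 : Vq q) 1) := volume.toSphere

/-- The dual Radon transform
`Ř[f](𝐱_p, 𝐱_q) = (1/A_q) ∫_𝕊 f(𝐱_p, ⟨𝐱_q, η⟩ η) dS(η)` (a spherical average). -/
def dualRadon (f : V p q → A) (z : V p q) : A :=
  ⨍ w : sphere (0 : Vq q) 1,
    f (z.1, (⟪((w : Vq q)), z.2⟫) • (w : Vq q)) ∂(sphMeasure q)

end GPS

open GPS

section AuxiliaryResults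

open Set
open scoped ContDiff Convolution

namespace GPS

section Localization

variable {E : Type*} [NormedAddCommGroup E] [NormedSpace ℝ E] [FiniteDimensional ℝ E]
  {W : Type*} [NormedAddCommGroup W] [NormedSpace ℝ W]

/-- A function that is `C^n` on an open set agrees near each of its points with a compactly
supported `C^n` function on the whole space. -/
theorem exists_contDiff_hasCompactSupport_eqOn_ball {n : ℕ∞} {u : E → W} {U : Set E}
    (hU : IsOpen U) (hu : ContDiffOn ℝ n u U) {x : E} (hx : x ∈ U) :
    ∃ (g : E → W) (ρ : ℝ), ContDiff ℝ n g ∧ HasCompactSupport g ∧ 0 < ρ ∧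
      ball x ρ ⊆ U ∧ EqOn g u (ball x ρ) := by
  obtain ⟨R, hR, hRU⟩ := Metric.isOpen_iff.1 hU x hx
  let χ : ContDiffBump x := ⟨R / 4, R / 2, by positivity, by linarith⟩
  refine ⟨fun y => χ y • u y, R / 4, ?_, χ.hasCompactSupport.smul_right, by positivity,
    (ball_subset_ball (by linarith)).trans hRU, fun y hy => ?_⟩
  · rw [contDiff_iff_contDiffAt]
    intro y
    by_cases hy : y ∈ ball x R
    · exact χ.contDiff.contDiffAt.smul (hu.contDiffAt (hU.mem_nhds (hRU hy)))
    · have hy' : y ∉ tsupport χ := by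
        rw [χ.tsupport_eq]
        intro h
        apply hy
        have : dist y x ≤ R / 2 := h
        exact mem_ball.2 (by linarith)
      have : (fun y => χ y • u y) =ᶠ[𝓝 y] fun _ => 0 := by
        filter_upwards [notMem_tsupport_iff_eventuallyEq.1 hy'] with z hz
        simp [hz]
      exact contDiffAt_const.congr_of_eventuallyEq this
  · simp [χ.one_of_mem_closedBall (ball_subset_closedBall hy)]

end Localization

section RadialKernel

variable {E : Type*} [NormedAddCommGroup E] [NormedSpace ℝ E] [FiniteDimensional ℝ E]
  {ι : Type*} [Fintype ι] (b : Module.Basis ι ℝ E)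

/-- The squared Euclidean norm with respect to a basis. -/
def sumSq (z : E) : ℝ := ∑ i, b.coord i z ^ 2

theorem hasFDerivAt_sumSq (z : E) :
    HasFDerivAt (sumSq b) (∑ i, (2 * b.coord i z) • LinearMap.toContinuousLinearMap (b.coord i))
      z := by
  unfold sumSq
  refine HasFDerivAt.fun_sum fun i _ => ?_
  have h : HasFDerivAt (fun y => b.coord i y) (LinearMap.toContinuousLinearMap (b.coord i)) z :=
    (LinearMap.toContinuousLinearMap (b.coord i)).hasFDerivAt
  simpa using h.pow 2

theorem contDiff_sumSq {n : ℕ∞ω} : ContDiff ℝ n (sumSq b) := by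
  unfold sumSq
  exact ContDiff.sum fun i _ => (LinearMap.toContinuousLinearMap (b.coord i)).contDiff.pow 2

omit [FiniteDimensional ℝ E] in
theorem norm_le_of_sumSq_le {z : E} {ρ : ℝ} (hρ : 0 ≤ ρ) (h : sumSq b z ≤ ρ ^ 2) :
    ‖z‖ ≤ ρ * ∑ i, ‖b i‖ := by
  have hi : ∀ i, |b.coord i z| ≤ ρ := fun i => by
    apply abs_le_of_sq_le_sq _ hρ
    exact (Finset.single_le_sum (f := fun i => b.coord i z ^ 2) (fun j _ => sq_nonneg _)
      (Finset.mem_univ i)).trans h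
  calc ‖z‖ = ‖∑ i, b.coord i z • b i‖ := by
        congr 1; exact (b.sum_repr z).symm
    _ ≤ ∑ i, ‖b.coord i z • b i‖ := norm_sum_le _ _
    _ ≤ ∑ i, ρ * ‖b i‖ := by
        gcongr with i
        rw [norm_smul]
        exact mul_le_mul_of_nonneg_right (hi i) (norm_nonneg _)
    _ = _ := by rw [Finset.mul_sum]

/-- There are smooth compactly supported `Φ`, `ψ`, supported in an arbitrarily small ball and
radial with respect to a basis, such that `∇Φ = -ψ(z) z` and `∫ ψ ≠ 0`. -/
theorem exists_radial_kernel [MeasurableSpace E] [BorelSpace E] (μ : Measure E)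
    [μ.IsAddHaarMeasure] [Nonempty ι] {δ : ℝ} (hδ : 0 < δ) :
    ∃ Φ ψ : E → ℝ, ContDiff ℝ ∞ Φ ∧ ContDiff ℝ ∞ ψ ∧ HasCompactSupport Φ ∧
      HasCompactSupport ψ ∧ tsupport Φ ⊆ closedBall 0 δ ∧ tsupport ψ ⊆ closedBall 0 δ ∧
      (∀ z i, fderiv ℝ Φ z (b i) = -(b.coord i z * ψ z)) ∧ ∫ z, ψ z ∂μ ≠ 0 := by
  obtain ⟨ρ, hρ, hρδ⟩ : ∃ ρ : ℝ, 0 < ρ ∧ ρ * ∑ i, ‖b i‖ ≤ δ := by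
    have hs : 0 ≤ ∑ i, ‖b i‖ := Finset.sum_nonneg fun i _ => norm_nonneg _
    refine ⟨δ / (1 + ∑ i, ‖b i‖), by positivity, ?_⟩
    rw [div_mul_eq_mul_div, div_le_iff₀ (by positivity)]
    nlinarith
  have hρ2 : 0 < ρ ^ 2 := by positivity
  set G : ℝ → ℝ := fun s => Real.smoothTransition (1 - s / ρ ^ 2) with hG
  have hGs : ContDiff ℝ ∞ G := Real.smoothTransition.contDiff.comp (by fun_prop)
  have hGd : Differentiable ℝ G := hGs.differentiable (by simp)
  have hG0 : ∀ s, ρ ^ 2 ≤ s → G s = 0 := fun s hs => by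
    apply Real.smoothTransition.zero_of_nonpos
    rw [sub_nonpos, le_div_iff₀ hρ2]; linarith
  have hGanti : Antitone G := fun s t hst => by
    apply Real.smoothTransition.monotone
    gcongr
  have hG'le : ∀ s, deriv G s ≤ 0 := fun s => hGanti.deriv_nonpos
  have hG' : ContDiff ℝ ∞ (deriv G) := hGs.deriv' 
  set Φ : E → ℝ := fun z => G (sumSq b z)
  set ψ : E → ℝ := fun z => -(2 * deriv G (sumSq b z))
  have hΦz : ∀ z, z ∉ closedBall (0 : E) δ → ρ ^ 2 < sumSq b z := fun z hz => by
    by_contra! h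
    apply hz
    rw [mem_closedBall_zero_iff]
    exact (norm_le_of_sumSq_le b hρ.le h).trans hρδ
  have hΦs : tsupport Φ ⊆ closedBall 0 δ := by
    refine closure_minimal (fun z hz => ?_) isClosed_closedBall
    by_contra h
    exact hz (hG0 _ (hΦz z h).le)
  have hψs : tsupport ψ ⊆ closedBall 0 δ := by
    refine closure_minimal (fun z hz => ?_) isClosed_closedBall
    by_contra h
    apply hz
    have : G =ᶠ[𝓝 (sumSq b z)] fun _ => 0 := by
      filter_upwards [lt_mem_nhds (hΦz z h)] with s hs using hG0 s hs.le
    simp [ψ, this.deriv_eq]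
  have hψc : ContDiff ℝ ∞ ψ := (contDiff_const.mul (hG'.comp (contDiff_sumSq b))).neg
  have hψcs : HasCompactSupport ψ :=
    (isCompact_closedBall 0 δ).of_isClosed_subset (isClosed_tsupport _) hψs
  have hψ0 : ∀ z, 0 ≤ ψ z := fun z => by
    have := hG'le (sumSq b z); simp only [ψ]; linarith
  refine ⟨Φ, ψ, hGs.comp (contDiff_sumSq b), hψc,
    (isCompact_closedBall 0 δ).of_isClosed_subset (isClosed_tsupport _) hΦs, hψcs, hΦs, hψs,
    fun z i => ?_, ?_⟩
  · have h : HasFDerivAt Φ _ z :=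
      (hGd (sumSq b z)).hasDerivAt.comp_hasFDerivAt z (hasFDerivAt_sumSq b z)
    classical
    rw [h.fderiv]
    simp [ψ, Finsupp.single_apply]
    ring
  · obtain ⟨s, ⟨hs0, hs1⟩, hs⟩ := exists_deriv_eq_slope G hρ2 hGd.continuous.continuousOn
      hGd.differentiableOn
    have hs' : deriv G s < 0 := by
      rw [hs, hG0 _ le_rfl]
      have : G 0 = 1 := by simp [hG, Real.smoothTransition.one]
      rw [this]
      apply div_neg_of_neg_of_pos <;> linarith
    classical
    obtain ⟨i⟩ := ‹Nonempty ι›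
    have hN : sumSq b (Real.sqrt s • b i) = s := by
      simp [sumSq, Finsupp.single_apply, ite_pow, Real.sq_sqrt hs0.le]
    refine ((hψc.continuous.integral_pos_of_hasCompactSupport_nonneg_nonzero hψcs hψ0
      (x := Real.sqrt s • b i) ?_)).ne'
    simp only [ψ, hN]
    linarith

end RadialKernel

end GPS

namespace GPS

section Regularity

variable {E : Type*} [NormedAddCommGroup E] [NormedSpace ℝ E] [FiniteDimensional ℝ E]
  {ι : Type*} [Fintype ι] (b : Module.Basis ι ℝ E)
  {A : Type*} [NormedRing A] [NormedAlgebra ℝ A]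
  [MeasurableSpace E] [BorelSpace E] {μ : Measure E} [μ.IsAddHaarMeasure]

omit [FiniteDimensional ℝ E] [MeasurableSpace E] [BorelSpace E] in
theorem fderiv_comp_sub_smul {u : E → A} (hu : ContDiff ℝ 1 u) (x : E) (s : ℝ) (y v : E) :
    fderiv ℝ (fun y => u (x - s • y)) y v = -(s • fderiv ℝ u (x - s • y) v) := by
  have h1 : HasFDerivAt (fun y : E => x - s • y) (-(s • ContinuousLinearMap.id ℝ E)) y :=
    ((hasFDerivAt_id y).const_smul s).const_sub x
  have h2 := ((hu.differentiable one_ne_zero) (x - s • y)).hasFDerivAt.comp y h1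
  have h3 : fderiv ℝ (fun y => u (x - s • y)) y = _ := h2.fderiv
  rw [h3]
  simp

theorem integral_fderiv_smul_fderiv_symm {Φ : E → ℝ} (hΦ : ContDiff ℝ ∞ Φ)
    (hΦc : HasCompactSupport Φ) {u : E → A} (hu : ContDiff ℝ 1 u) (x : E) {s : ℝ} (hs : s ≠ 0)
    (v w : E) :
    ∫ y, fderiv ℝ Φ y v • fderiv ℝ u (x - s • y) w ∂μ =
      ∫ y, fderiv ℝ Φ y w • fderiv ℝ u (x - s • y) v ∂μ := by
  have hd : ∀ v, ContDiff ℝ 1 fun y => fderiv ℝ Φ y v := fun v =>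
    (hΦ.fderiv_right (m := 1) (by norm_cast)).clm_apply contDiff_const
  have hdc : ∀ v, HasCompactSupport fun y => fderiv ℝ Φ y v := fun v => hΦc.fderiv_apply ℝ v
  have hU : ContDiff ℝ 1 fun y => u (x - s • y) := hu.comp (by fun_prop)
  have key : ∀ v w, ∫ y, fderiv ℝ Φ y v • fderiv ℝ u (x - s • y) w ∂μ =
      s⁻¹ • ∫ y, fderiv ℝ (fun y => fderiv ℝ Φ y v) y w • u (x - s • y) ∂μ := fun v w => by
    have h := integral_smul_fderiv_eq_neg_fderiv_smul_of_integrable (μ := μ)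
      (f := fun y => fderiv ℝ Φ y v) (g := fun y => u (x - s • y)) (v := w)
      ?_ ?_ ?_ (fun y _ => (hd v).differentiable one_ne_zero y)
      (fun y _ => hU.differentiable one_ne_zero y)
    · simp_rw [fderiv_comp_sub_smul hu, smul_neg, integral_neg, smul_comm _ s,
        integral_smul] at h
      rw [← neg_injective h, smul_smul, inv_mul_cancel₀ hs, one_smul]
    · exact ((((hd v).continuous_fderiv one_ne_zero).clm_apply continuous_const).smul
        hU.continuous).integrable_of_hasCompactSupport ((hdc v).fderiv_apply ℝ w).smul_right
    · exact ((hd v).continuous.smul ((hU.continuous_fderiv one_ne_zero).clm_apply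
        continuous_const)).integrable_of_hasCompactSupport (hdc v).smul_right
    · exact ((hd v).continuous.smul hU.continuous).integrable_of_hasCompactSupport
        (hdc v).smul_right
  rw [key, key]
  congr 2 with y
  congr 1
  have hsym : IsSymmSndFDerivAt ℝ Φ y := hΦ.contDiffAt.isSymmSndFDerivAt (by simp; norm_cast)
  have hD : Differentiable ℝ (fderiv ℝ Φ) :=
    (hΦ.fderiv_right (m := 1) (by norm_cast)).differentiable one_ne_zero
  rw [fderiv_clm_apply (hD y) (differentiableAt_const _),
    fderiv_clm_apply (hD y) (differentiableAt_const _)]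
  simpa using hsym w v

variable {a c : ι → A}

theorem integral_sum_fderiv_smul_fderiv_eq_zero [DecidableEq ι]
    (hac : ∀ i j, c i * a j + c j * a i = if i = j then 2 else 0) [CompleteSpace A]
    {Φ : E → ℝ} (hΦ : ContDiff ℝ ∞ Φ) (hΦc : HasCompactSupport Φ)
    {u : E → A} (hu : ContDiff ℝ 1 u) (x : E) {s : ℝ} (hs : s ≠ 0)
    (hD : ∀ y ∈ tsupport Φ, ∑ i, a i * fderiv ℝ u (x - s • y) (b i) = 0) :
    ∑ i, ∫ y, fderiv ℝ Φ y (b i) • fderiv ℝ u (x - s • y) (b i) ∂μ = 0 := by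
  set I : ι → ι → A := fun i j => ∫ y, fderiv ℝ Φ y (b i) • fderiv ℝ u (x - s • y) (b j) ∂μ
  have hint : ∀ i j, Integrable (fun y => fderiv ℝ Φ y (b i) • fderiv ℝ u (x - s • y) (b j)) μ :=
    fun i j => Continuous.integrable_of_hasCompactSupport
      (((hΦ.continuous_fderiv (by simp)).clm_apply continuous_const).smul
        (((hu.continuous_fderiv one_ne_zero).comp (by fun_prop)).clm_apply continuous_const))
      (hΦc.fderiv_apply ℝ _).smul_right
  have hsymm : ∀ i j, I i j = I j i := fun i j =>
    integral_fderiv_smul_fderiv_symm hΦ hΦc hu x hs _ _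
  have hz : ∀ i, ∑ j, a j * I i j = 0 := fun i => by
    have h1 : ∀ j, a j * I i j =
        ∫ y, a j * (fderiv ℝ Φ y (b i) • fderiv ℝ u (x - s • y) (b j)) ∂μ := fun j =>
      ((ContinuousLinearMap.mul ℝ A (a j)).integral_comp_comm (hint i j)).symm
    simp_rw [h1]
    rw [← integral_finsetSum]
    swap
    · exact fun j _ => (ContinuousLinearMap.mul ℝ A (a j)).integrable_comp (hint i j)
    rw [← integral_zero E A (μ := μ)]
    congr 1 with y
    by_cases hy : y ∈ tsupport Φ
    · simp_rw [mul_smul_comm, ← Finset.smul_sum, hD y hy, smul_zero]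
    · have : fderiv ℝ Φ y = 0 := by
        rw [(notMem_tsupport_iff_eventuallyEq.1 hy).fderiv_eq]; simp
      simp [this]
  have h2 : (2 : ℝ) • ∑ i, I i i = 0 := by
    calc (2 : ℝ) • ∑ i, I i i = ∑ i, ∑ j, (c i * a j + c j * a i) * I i j := by
          rw [Finset.smul_sum]
          refine Finset.sum_congr rfl fun i _ => ?_
          simp_rw [hac, ite_mul, zero_mul]
          rw [Finset.sum_ite_eq]
          simp [two_smul, two_mul]
      _ = ∑ i, c i * ∑ j, a j * I i j + ∑ j, c j * ∑ i, a i * I j i := by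
          simp_rw [add_mul, Finset.sum_add_distrib, Finset.mul_sum, mul_assoc]
          congr 1
          rw [Finset.sum_comm]
          simp_rw [hsymm]
      _ = 0 := by simp [hz]
  exact (smul_eq_zero.1 h2).resolve_left two_ne_zero

/-- Mean value property for solutions of a first-order system squaring to the Laplacian. -/
theorem integral_smul_eq_integral_smul_comp_sub [DecidableEq ι]
    (hac : ∀ i j, c i * a j + c j * a i = if i = j then 2 else 0) [CompleteSpace A]
    {Φ ψ : E → ℝ} (hΦ : ContDiff ℝ ∞ Φ) (hψ : ContDiff ℝ ∞ ψ) (hΦc : HasCompactSupport Φ)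
    (hψc : HasCompactSupport ψ)
    (hΦψ : ∀ z i, fderiv ℝ Φ z (b i) = -(b.coord i z * ψ z))
    {u : E → A} (hu : ContDiff ℝ 1 u) (huc : HasCompactSupport u) (x : E)
    (hD : ∀ y ∈ tsupport Φ, ∀ s ∈ Ioc (0 : ℝ) 1,
      ∑ i, a i * fderiv ℝ u (x - s • y) (b i) = 0) :
    (∫ y, ψ y ∂μ) • u x = ∫ y, ψ y • u (x - y) ∂μ := by
  set M : ℝ → A := fun t => ∫ y, ψ y • u (x - (1 - t) • y) ∂μ
  obtain ⟨C, hC⟩ : ∃ C, ∀ y, ‖fderiv ℝ u y‖ ≤ C :=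
    (huc.fderiv ℝ).exists_bound_of_continuous (hu.continuous_fderiv one_ne_zero)
  have hM : ∀ t, HasDerivAt M (∫ y, ψ y • fderiv ℝ u (x - (1 - t) • y) y ∂μ) t := fun t => by
    refine (hasDerivAt_integral_of_dominated_loc_of_deriv_le (𝕜 := ℝ) (s := univ)
      (F := fun t y => ψ y • u (x - (1 - t) • y))
      (F' := fun t y => ψ y • fderiv ℝ u (x - (1 - t) • y) y)
      (bound := fun y => ‖ψ y‖ * (C * ‖y‖)) univ_mem (Eventually.of_forall fun t => ?_) ?_
      ?_ (Eventually.of_forall fun y t _ => ?_) ?_ (Eventually.of_forall fun y t _ => ?_)).2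
    · exact (hψ.continuous.smul (hu.continuous.comp (by fun_prop))).aestronglyMeasurable
    · exact (hψ.continuous.smul (hu.continuous.comp
        (by fun_prop))).integrable_of_hasCompactSupport hψc.smul_right
    · exact (hψ.continuous.smul (((hu.continuous_fderiv one_ne_zero).comp
        (by fun_prop)).clm_apply continuous_id)).aestronglyMeasurable
    · rw [norm_smul]
      exact mul_le_mul_of_nonneg_left ((ContinuousLinearMap.le_opNorm _ _).trans
        (mul_le_mul_of_nonneg_right (hC _) (norm_nonneg _))) (norm_nonneg _)
    · exact (hψ.continuous.norm.mul
        (by fun_prop)).integrable_of_hasCompactSupport hψc.norm.mul_right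
    · have h1 : HasDerivAt (fun t : ℝ => x - (1 - t) • y) y t := by
        simpa using (((hasDerivAt_id t).const_sub 1).smul_const y).const_sub x
      exact ((hu.differentiable one_ne_zero _).hasFDerivAt.comp_hasDerivAt t h1).const_smul (ψ y)
  have hM0 : ∀ t ∈ Ico (0 : ℝ) 1, ∫ y, ψ y • fderiv ℝ u (x - (1 - t) • y) y ∂μ = 0 := by
    intro t ht
    have hs : (1 - t) ∈ Ioc (0 : ℝ) 1 := ⟨by linarith [ht.2], by linarith [ht.1]⟩
    have h := integral_sum_fderiv_smul_fderiv_eq_zero b (μ := μ) hac hΦ hΦc hu x hs.1.ne'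
      fun y hy => hD y hy _ hs
    rw [← integral_finsetSum] at h
    · rw [← neg_eq_zero, ← integral_neg, ← h]
      congr 1 with y
      conv_lhs => rw [← b.sum_repr y, map_sum, Finset.smul_sum, b.sum_repr y]
      rw [← Finset.sum_neg_distrib]
      refine Finset.sum_congr rfl fun i _ => ?_
      rw [hΦψ, map_smul, smul_smul, neg_smul, mul_comm]
      rfl
    · intro i _
      exact Continuous.integrable_of_hasCompactSupport
        (((hΦ.continuous_fderiv (by simp)).clm_apply continuous_const).smul
          (((hu.continuous_fderiv one_ne_zero).comp (by fun_prop)).clm_apply continuous_const))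
        (hΦc.fderiv_apply ℝ _).smul_right
  have hconst := constant_of_derivWithin_zero (f := M) (a := 0) (b := 1)
    (fun t _ => (hM t).differentiableAt.differentiableWithinAt) (fun t ht => by
      rw [(hM t).hasDerivWithinAt.derivWithin
        (uniqueDiffOn_Icc zero_lt_one t (Ico_subset_Icc_self ht)), hM0 t ht])
    1 (right_mem_Icc.2 zero_le_one)
  simpa [M, integral_smul_const] using hconst

omit [MeasurableSpace E] [BorelSpace E] in
/-- Interior regularity: a `C^1` solution of a first-order system with constant coefficients
squaring to the Laplacian is smooth. -/
theorem contDiffOn_of_dirac [DecidableEq ι] [Nonempty ι]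
    (hac : ∀ i j, c i * a j + c j * a i = if i = j then 2 else 0) [CompleteSpace A]
    {U : Set E} (hU : IsOpen U) {u : E → A} (hu : ContDiffOn ℝ 1 u U)
    (hD : ∀ y ∈ U, ∑ i, a i * fderiv ℝ u y (b i) = 0) : ContDiffOn ℝ ∞ u U := by
  let _ : MeasurableSpace E := borel E
  have : BorelSpace E := ⟨rfl⟩
  let μ : Measure E := Measure.addHaar
  intro x hx
  refine ContDiffAt.contDiffWithinAt ?_
  obtain ⟨g, ρ, hg, hgc, hρ, hρU, hgu⟩ :=
    exists_contDiff_hasCompactSupport_eqOn_ball (n := 1) hU hu hx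
  obtain ⟨Φ, ψ, hΦ, hψ, hΦc, hψc, hΦδ, hψδ, hΦψ, hψ0⟩ :=
    exists_radial_kernel b μ (show 0 < ρ / 4 by positivity)
  have hDg : ∀ y ∈ ball x ρ, ∑ i, a i * fderiv ℝ g y (b i) = 0 := fun y hy => by
    rw [(hgu.eventuallyEq_of_mem (isOpen_ball.mem_nhds hy)).fderiv_eq]
    exact hD y (hρU hy)
  have hmv : ∀ y ∈ ball x (ρ / 2), (∫ z, ψ z ∂μ) • g y = ∫ z, ψ z • g (y - z) ∂μ := fun y hy => by
    refine integral_smul_eq_integral_smul_comp_sub b hac hΦ hψ hΦc hψc hΦψ hg hgc y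
      fun z hz s hs => hDg _ ?_
    have h1 : ‖z‖ ≤ ρ / 4 := mem_closedBall_zero_iff.1 (hΦδ hz)
    have h2 : ‖s • z‖ ≤ ρ / 4 := by
      rw [norm_smul, Real.norm_of_nonneg hs.1.le]
      nlinarith [norm_nonneg z, hs.1, hs.2]
    have h3 := mem_ball_iff_norm.1 hy
    rw [mem_ball_iff_norm]
    calc ‖y - s • z - x‖ = ‖(y - x) - s • z‖ := by congr 1; abel
      _ ≤ ‖y - x‖ + ‖s • z‖ := norm_sub_le _ _
      _ < ρ := by linarith
  have hconv : ContDiff ℝ ∞ (ψ ⋆[ContinuousLinearMap.lsmul ℝ ℝ, μ] g) :=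
    hψc.contDiff_convolution_left _ hψ hg.continuous.locallyIntegrable
  refine ((hconv.const_smul (∫ z, ψ z ∂μ)⁻¹).contDiffAt).congr_of_eventuallyEq ?_
  filter_upwards [ball_mem_nhds x (show 0 < ρ / 2 by positivity)] with y hy
  rw [← hgu (ball_subset_ball (by linarith) hy)]
  change _ = (∫ z, ψ z ∂μ)⁻¹ • ∫ z, ψ z • g (y - z) ∂μ
  rw [← hmv y hy, smul_smul, inv_mul_cancel₀ hψ0, one_smul]

end Regularity

end GPS

namespace GPS

section Hadamard

variable {X W : Type*} [NormedAddCommGroup X] [NormedSpace ℝ X]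
  [NormedAddCommGroup W] [NormedSpace ℝ W]

theorem contDiff_integral_comp_mul_snd {g : X × ℝ → W} (hg : ContDiff ℝ ∞ g) :
    ContDiff ℝ ∞ fun z : X × ℝ => ∫ t in (0 : ℝ)..1, g (z.1, t * z.2) := by
  let χ : ContDiffBump (0 : ℝ) := ⟨1, 2, one_pos, one_lt_two⟩
  let f : ℝ → ℝ := indicator (Ioc 0 1) fun _ => 1
  let G : X × ℝ → ℝ → W := fun z t => χ t • g (z.1, -t * z.2)
  have hf : LocallyIntegrable f volume := by
    apply Integrable.locallyIntegrable
    rw [integrable_indicator_iff measurableSet_Ioc]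
    simp
  have h := contDiffOn_convolution_right_with_param_comp (μ := volume) (n := ⊤)
    (ContinuousLinearMap.lsmul ℝ ℝ : ℝ →L[ℝ] W →L[ℝ] W) (s := (univ : Set (X × ℝ)))
    (v := fun _ => (0 : ℝ)) contDiffOn_const (f := f) (g := G) isOpen_univ
    (isCompact_closedBall (0 : ℝ) 2)
    (fun z t _ ht => by
      have : χ t = 0 := χ.zero_of_le_dist (by
        rw [mem_closedBall, not_le] at ht
        exact ht.le)
      simp [G, this]) hf ?_
  · rw [contDiffOn_univ] at h
    convert h using 2 with z
    rw [convolution_def, intervalIntegral.integral_of_le zero_le_one, ← integral_indicator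
      measurableSet_Ioc]
    congr 1 with t
    by_cases ht : t ∈ Ioc (0 : ℝ) 1
    · have : χ (-t) = 1 := χ.one_of_mem_closedBall (by
        rw [mem_closedBall_zero_iff, norm_neg, Real.norm_of_nonneg ht.1.le]; exact ht.2)
      simp [f, G, ht, this]
    · simp [f, ht]
  · apply ContDiff.contDiffOn
    exact (χ.contDiff.comp contDiff_snd).smul (hg.comp (by fun_prop))

end Hadamard

variable {p q : ℕ} {W : Type*} [NormedAddCommGroup W] [NormedSpace ℝ W]

/-- Smooth functions on `D` that are even in the last variable. -/
def SmoothEven (D : Set (Sl p)) (F : Sl p → W) : Prop :=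
  ContDiffOn ℝ ∞ F D ∧ ∀ z ∈ D, F (z.1, -z.2) = F z

/-- Smooth functions on `D` that are odd in the last variable. -/
def SmoothOdd (D : Set (Sl p)) (F : Sl p → W) : Prop :=
  ContDiffOn ℝ ∞ F D ∧ ∀ z ∈ D, F (z.1, -z.2) = -F z

/-- The quotient `F / r`, extended to `r = 0` by `∂_r F`. -/
def divR (F : Sl p → W) : Sl p → W :=
  fun z => if z.2 = 0 then pdr p F z else z.2⁻¹ • F z

/-- The operator `(1/r) ∂_r`, extended to `r = 0` by `∂_r²`. -/
def radT (F : Sl p → W) : Sl p → W := divR (pdr p F)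

variable {D : Set (Sl p)} {F G : Sl p → W}

theorem mem_zero_of_ball {x : Vp p} {ρ : ℝ} {z : Sl p} (hz : z ∈ ball ((x, 0) : Sl p) ρ) {t : ℝ}
    (ht : t ∈ Icc (0 : ℝ) 1) : ((z.1, t * z.2) : Sl p) ∈ ball ((x, 0) : Sl p) ρ := by
  rw [mem_ball, Prod.dist_eq, max_lt_iff] at hz ⊢
  refine ⟨hz.1, lt_of_le_of_lt ?_ hz.2⟩
  simp only [Real.dist_eq, sub_zero, abs_mul, abs_of_nonneg ht.1]
  exact mul_le_of_le_one_left (abs_nonneg _) ht.2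

theorem SmoothOdd.eq_zero (hF : SmoothOdd D F) {x : Vp p} (hx : ((x, 0) : Sl p) ∈ D) :
    F (x, 0) = 0 := by
  have h : F (x, 0) = -F (x, 0) := by simpa using hF.2 _ hx
  have h2 : (2 : ℝ) • F (x, 0) = 0 := by rw [two_smul, add_eq_zero_iff_eq_neg]; exact h
  exact (smul_eq_zero.1 h2).resolve_left two_ne_zero

theorem SmoothOdd.smul_divR (hF : SmoothOdd D F) {z : Sl p} (hz : z ∈ D) :
    z.2 • divR F z = F z := by
  obtain ⟨x, r⟩ := z
  by_cases hr : r = 0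
  · subst hr
    simp [hF.eq_zero hz]
  · simp [divR, hr]

theorem SmoothOdd.divR [CompleteSpace W] (hD : IsOpen D) (hF : SmoothOdd D F) :
    SmoothEven D (divR F) := by
  constructor
  · rintro ⟨x, r⟩ hz
    refine ContDiffAt.contDiffWithinAt ?_
    by_cases hr : r = 0
    · subst hr
      obtain ⟨g, ρ, hg, -, hρ, hρD, hgF⟩ :=
        exists_contDiff_hasCompactSupport_eqOn_ball (n := ⊤) hD hF.1 hz
      have hg1 : ContDiff ℝ ∞ (pdr p g) :=
        (hg.fderiv_right (m := ∞) (by simp)).clm_apply contDiff_const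
      refine (contDiff_integral_comp_mul_snd hg1).contDiffAt.congr_of_eventuallyEq ?_
      filter_upwards [ball_mem_nhds _ hρ] with z hzρ
      have hz0 : ((z.1, 0) : Sl p) ∈ ball ((x, 0) : Sl p) ρ := by
        simpa using mem_zero_of_ball hzρ (left_mem_Icc.2 zero_le_one)
      by_cases hz2 : z.2 = 0
      · have : fderiv ℝ g z = fderiv ℝ F z :=
          (hgF.eventuallyEq_of_mem (isOpen_ball.mem_nhds hzρ)).fderiv_eq
        obtain ⟨y, s⟩ := z
        simp only at hz2
        subst hz2
        simp [GPS.divR, pdr, this]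
      · have h1 : ∀ t ∈ uIcc (0 : ℝ) 1, HasDerivAt (fun t : ℝ => g (z.1, t * z.2))
            (z.2 • pdr p g (z.1, t * z.2)) t := fun t _ => by
          have h2 : HasDerivAt (fun t : ℝ => ((z.1, t * z.2) : Sl p)) (0, z.2) t := by
            refine (hasDerivAt_const t z.1).prodMk ?_
            simpa using (hasDerivAt_id t).mul_const z.2
          have h3 := ((hg.differentiable (by simp)) (z.1, t * z.2)).hasFDerivAt.comp_hasDerivAt t h2
          have h4 : ((0, z.2) : Sl p) = z.2 • (0, 1) := by simp
          rw [h4, map_smul] at h3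
          exact h3
        have h5 := intervalIntegral.integral_eq_sub_of_hasDerivAt h1
          (Continuous.intervalIntegrable ((hg1.continuous.comp (by fun_prop)).const_smul _) _ _)
        rw [intervalIntegral.integral_smul] at h5
        simp only [one_mul, zero_mul, hgF hz0, hF.eq_zero (hρD hz0), sub_zero] at h5
        have h6 : g (z.1, z.2) = F z := hgF hzρ
        rw [h6] at h5
        simp only [GPS.divR, hz2, if_false]
        rw [← h5, smul_smul, inv_mul_cancel₀ hz2, one_smul]
    · have h1 : ContDiffAt ℝ ∞ (fun z : Sl p => z.2⁻¹ • F z) (x, r) :=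
        (contDiffAt_snd.inv hr).smul (hF.1.contDiffAt (hD.mem_nhds hz))
      refine h1.congr_of_eventuallyEq ?_
      filter_upwards [continuousAt_snd.eventually_ne (y := (0 : ℝ)) (x := ((x, r) : Sl p)) hr]
        with z hz
      simp [GPS.divR, hz]
  · rintro ⟨x, r⟩ hz
    by_cases hr : r = 0
    · simp [hr]
    · simp [GPS.divR, hr, hF.2 _ hz, inv_neg]

theorem fderiv_reflect {s : ℝ} (hD : IsOpen D) (hF : ∀ z ∈ D, F (z.1, -z.2) = s • F z)
    (hFd : ContDiffOn ℝ ∞ F D) (hr : ReflInv p D) {z : Sl p} (hz : z ∈ D) (v : Vp p) (w : ℝ) :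
    fderiv ℝ F (z.1, -z.2) (v, -w) = s • fderiv ℝ F z (v, w) := by
  let σ : Sl p →L[ℝ] Sl p := (ContinuousLinearMap.fst ℝ _ _).prod (-ContinuousLinearMap.snd ℝ _ _)
  have h1 : (fun z => F (σ z)) =ᶠ[𝓝 z] fun z => s • F z := by
    filter_upwards [hD.mem_nhds hz] with y hy using hF y hy
  have hd : ∀ {z}, z ∈ D → DifferentiableAt ℝ F z := fun h =>
    (hFd.contDiffAt (hD.mem_nhds h)).differentiableAt (by simp)
  have h2 : HasFDerivAt (fun z => F (σ z)) ((fderiv ℝ F (σ z)).comp σ) z :=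
    (hd (z := σ z) (hr z hz)).hasFDerivAt.comp z σ.hasFDerivAt
  have h3 := h2.unique (((hd hz).hasFDerivAt.const_smul s).congr_of_eventuallyEq h1)
  have h4 := congrArg (fun L => L (v, w)) h3
  exact h4

theorem contDiffOn_fderiv_apply (hD : IsOpen D) (hF : ContDiffOn ℝ ∞ F D) (v : Sl p) :
    ContDiffOn ℝ ∞ (fun z => fderiv ℝ F z v) D :=
  (hF.fderiv_of_isOpen hD (by simp)).clm_apply contDiffOn_const

theorem SmoothEven.fderiv_inl (hD : IsOpen D) (hr : ReflInv p D) (hF : SmoothEven D F) (v : Vp p) :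
    SmoothEven D fun z => fderiv ℝ F z (v, 0) :=
  ⟨contDiffOn_fderiv_apply hD hF.1 _, fun z hz => by
    simpa using fderiv_reflect (s := 1) hD (by simpa using hF.2) hF.1 hr hz v 0⟩

theorem SmoothOdd.fderiv_inl (hD : IsOpen D) (hr : ReflInv p D) (hF : SmoothOdd D F) (v : Vp p) :
    SmoothOdd D fun z => fderiv ℝ F z (v, 0) :=
  ⟨contDiffOn_fderiv_apply hD hF.1 _, fun z hz => by
    simpa using fderiv_reflect (s := -1) hD (by simpa using hF.2) hF.1 hr hz v 0⟩

theorem SmoothEven.pdr (hD : IsOpen D) (hr : ReflInv p D) (hF : SmoothEven D F) :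
    SmoothOdd D (pdr p F) :=
  ⟨contDiffOn_fderiv_apply hD hF.1 _, fun z hz => by
    have h := fderiv_reflect (s := 1) hD (by simpa using hF.2) hF.1 hr hz 0 (-1)
    simp only [neg_neg, one_smul] at h
    have h1 : ((0, -1) : Sl p) = -(0, 1) := by simp
    rw [h1, map_neg] at h
    exact h⟩

theorem SmoothEven.radT [CompleteSpace W] (hD : IsOpen D) (hr : ReflInv p D)
    (hF : SmoothEven D F) : SmoothEven D (radT F) :=
  (hF.pdr hD hr).divR hD

theorem SmoothEven.smul_radT (hD : IsOpen D) (hr : ReflInv p D) (hF : SmoothEven D F) {z : Sl p}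
    (hz : z ∈ D) : z.2 • GPS.radT F z = GPS.pdr p F z :=
  (hF.pdr hD hr).smul_divR hz

/-- The points of `ℝ^{p+q+1}` whose cylindrical coordinates lie in `D`. -/
def cyl (q : ℕ) (D : Set (Sl p)) : Set (V p q) := {z | ((z.1, ‖z.2‖) : Sl p) ∈ D}

theorem isOpen_cyl (hD : IsOpen D) : IsOpen (cyl q D) :=
  hD.preimage (by fun_prop : Continuous fun z : V p q => ((z.1, ‖z.2‖) : Sl p))

/-- The axially symmetric function on `ℝ^{p+q+1}` with profile `F`. -/
def axial (q : ℕ) (F : Sl p → W) : V p q → W := fun z => F (z.1, ‖z.2‖)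

theorem SmoothEven.hasFDerivAt_axial (hD : IsOpen D) (hr : ReflInv p D) (hF : SmoothEven D F)
    {z : V p q} (hz : z ∈ cyl q D) :
    HasFDerivAt (axial q F)
      ((fderiv ℝ F (z.1, ‖z.2‖)).comp ((ContinuousLinearMap.inl ℝ (Vp p) ℝ).comp
        (ContinuousLinearMap.fst ℝ (Vp p) (Vq q))) +
      ((innerSL ℝ z.2).comp (ContinuousLinearMap.snd ℝ (Vp p) (Vq q))).smulRight
        (axial q (GPS.radT F) z)) z := by
  obtain ⟨x, y⟩ := z
  have hd : HasFDerivAt F (fderiv ℝ F (x, ‖y‖)) (x, ‖y‖) :=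
    ((hF.1.contDiffAt (hD.mem_nhds hz)).differentiableAt (by simp)).hasFDerivAt
  have hT : ‖y‖ • GPS.radT F (x, ‖y‖) = fderiv ℝ F (x, ‖y‖) (0, 1) := hF.smul_radT hD hr hz
  by_cases hy : y = 0
  · subst hy
    rw [norm_zero, zero_smul] at hT
    rw [norm_zero] at hd
    have h1 := hd.isLittleO
    have ht : Tendsto (fun z : V p q => ((z.1, ‖z.2‖) : Sl p)) (𝓝 (x, 0)) (𝓝 (x, 0)) := by
      have : Continuous fun z : V p q => ((z.1, ‖z.2‖) : Sl p) := by fun_prop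
      simpa using this.tendsto (x, 0)
    refine HasFDerivAt.of_isLittleO ?_
    have h2 := h1.comp_tendsto ht
    refine (h2.congr_left fun z => ?_).trans_le fun z => ?_
    · have h3 : ((z.1, ‖z.2‖) : Sl p) - (x, 0) = (z.1 - x, 0) + ‖z.2‖ • (0, 1) := by simp
      simp only [Function.comp, h3, map_add, map_smul]
      simp [axial, ← hT]
    · simp [Prod.norm_def]
  · have hy' : ‖y‖ ≠ 0 := norm_ne_zero_iff.2 hy
    have hn : HasFDerivAt (fun z : V p q => ‖z.2‖)
        (‖y‖⁻¹ • (innerSL ℝ y).comp (ContinuousLinearMap.snd ℝ (Vp p) (Vq q))) (x, y) := by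
      have h1 := ((hasStrictFDerivAt_norm_sq y).hasFDerivAt.sqrt (by positivity))
      simp only [Real.sqrt_sq (norm_nonneg _)] at h1
      have h2 : HasFDerivAt (fun z : V p q => z.2) (ContinuousLinearMap.snd ℝ (Vp p) (Vq q)) (x, y) :=
        hasFDerivAt_snd
      refine (HasFDerivAt.comp (x, y) h1 h2).congr_fderiv (ContinuousLinearMap.ext fun w => ?_)
      simp
      field_simp
    have h : HasFDerivAt (axial q F) _ ((x, y) : V p q) :=
      HasFDerivAt.comp ((x, y) : V p q) hd (hasFDerivAt_fst.prodMk hn)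
    refine h.congr_fderiv (ContinuousLinearMap.ext fun w => ?_)
    have h3 : ((w.1, ‖y‖⁻¹ * ⟪y, w.2⟫) : Sl p) = (w.1, 0) + (‖y‖⁻¹ * ⟪y, w.2⟫) • (0, 1) := by simp
    have h4 : (fderiv ℝ F (x, ‖y‖)) (w.1, ‖y‖⁻¹ * ⟪y, w.2⟫) =
        fderiv ℝ F (x, ‖y‖) (w.1, 0) + ⟪y, w.2⟫ • GPS.radT F (x, ‖y‖) := by
      rw [h3, map_add, map_smul, ← hT, smul_smul]
      congr 2
      field_simp
    exact h4

theorem SmoothEven.fderiv_axial (hD : IsOpen D) (hr : ReflInv p D) (hF : SmoothEven D F)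
    {z : V p q} (hz : z ∈ cyl q D) (v : Vp p) (w : Vq q) :
    fderiv ℝ (axial q F) z (v, w) =
      axial q (fun z => fderiv ℝ F z (v, 0)) z + ⟪z.2, w⟫ • axial q (GPS.radT F) z := by
  rw [(hF.hasFDerivAt_axial hD hr hz).fderiv]
  simp [axial]

theorem SmoothEven.contDiffOn_axial [CompleteSpace W] (hD : IsOpen D) (hr : ReflInv p D)
    (hF : SmoothEven D F) : ContDiffOn ℝ ∞ (axial q F) (cyl q D) := by
  rw [contDiffOn_infty]
  intro n
  induction n generalizing F with
  | zero =>
    rw [Nat.cast_zero, contDiffOn_zero]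
    exact fun z hz => (hF.hasFDerivAt_axial hD hr hz).continuousAt.continuousWithinAt
  | succ n ih =>
    rw [Nat.cast_succ, contDiffOn_succ_iff_fderiv_of_isOpen (isOpen_cyl hD)]
    refine ⟨fun z hz => (hF.hasFDerivAt_axial hD hr hz).differentiableAt.differentiableWithinAt,
      by simp, ?_⟩
    rw [contDiffOn_clm_apply]
    rintro ⟨v, w⟩
    refine ContDiffOn.congr ?_ fun z hz => hF.fderiv_axial hD hr hz v w
    exact (ih (hF.fderiv_inl hD hr v)).add
      (ContDiffOn.smul (contDiff_snd.inner ℝ contDiff_const).contDiffOn (ih (hF.radT hD hr)))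

end GPS

namespace GPS

section CliffordRelations

theorem sum_sum_mul_of_add_swap {ι A : Type*} [Fintype ι] [DecidableEq ι] [Ring A] [Algebra ℝ A]
    {m H : ι → ι → A} {s : A} (hm : ∀ i j, m i j + m j i = if i = j then 2 * s else 0)
    (hH : ∀ i j, H i j = H j i) : ∑ i, ∑ j, m i j * H i j = ∑ i, s * H i i := by
  have h2 : IsUnit (2 : A) := by
    simpa [map_ofNat] using (IsUnit.mk0 (2 : ℝ) two_ne_zero).map (algebraMap ℝ A)
  refine h2.mul_left_cancel ?_
  rw [two_mul]
  nth_rw 2 [Finset.sum_comm]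
  simp only [← Finset.sum_add_distrib]
  have h : ∀ i j, m i j * H i j + m j i * H j i = if i = j then 2 * s * H i i else 0 := by
    intro i j
    rw [hH j i, ← add_mul, hm]
    by_cases hij : i = j
    · simp [hij]
    · simp [hij]
  simp [h, Finset.mul_sum, mul_assoc]

variable {p q : ℕ} {A : Type*} [NormedRing A] [NormedAlgebra ℝ A] (ξ : A ≃ₐ[ℝ] Cl (p + q))

theorem e_mul_add_swap (n : ℕ) (i j : Fin n) :
    e n i * e n j + e n j * e n i = if i = j then -2 else 0 := by
  have h : QuadraticMap.polar (Qe n) (Pi.single i 1) (Pi.single j 1) =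
      if i = j then (-2 : ℝ) else 0 := by
    have hs : ∀ k : Fin n, ∑ x, (Pi.single k (1 : ℝ) : Fin n → ℝ) x *
        (Pi.single k (1 : ℝ) : Fin n → ℝ) x = 1 := fun k => by simp [Pi.single_apply]
    simp only [QuadraticMap.polar, Qe, QuadraticMap.weightedSumSquares_apply, Pi.add_apply,
      smul_eq_mul, neg_one_mul, Finset.sum_neg_distrib, mul_add, add_mul, Finset.sum_add_distrib, hs]
    simp only [Pi.single_apply, ite_mul, one_mul, zero_mul, Finset.sum_ite_eq', Finset.mem_univ,
      if_true]
    by_cases hij : i = j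
    · subst hij; norm_num
    · simp [hij, Ne.symm hij]
  rw [e, e, CliffordAlgebra.ι_mul_ι_add_swap, h]
  split_ifs <;> simp [map_ofNat]

theorem gen_mul_add_swap (i j : Fin (p + q)) :
    gen p q ξ i * gen p q ξ j + gen p q ξ j * gen p q ξ i = if i = j then -2 else 0 := by
  rw [gen, gen, ← map_mul, ← map_mul, ← map_add, e_mul_add_swap]
  split_ifs <;> simp [map_ofNat]

theorem eQ_mul_add_swap (i j : Fin q) :
    eQ p q ξ i * eQ p q ξ j + eQ p q ξ j * eQ p q ξ i = if i = j then -2 else 0 := by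
  rw [eQ, eQ, gen_mul_add_swap]
  simp [Fin.ext_iff]

theorem eP_mul_add_swap (i j : Fin p) :
    eP p q ξ i * eP p q ξ j + eP p q ξ j * eP p q ξ i = if i = j then -2 else 0 := by
  rw [eP, eP, gen_mul_add_swap]
  simp [Fin.ext_iff]

theorem eP_mul_eQ (i : Fin p) (j : Fin q) :
    eP p q ξ i * eQ p q ξ j = -(eQ p q ξ j * eP p q ξ i) := by
  rw [← add_eq_zero_iff_eq_neg, eP, eQ, gen_mul_add_swap, if_neg]
  have := i.isLt
  simp only [Fin.mk.injEq]
  omega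

theorem εp_zero : εp p q ξ 0 = 1 := by simp [εp]

theorem εp_succ (i : Fin p) : εp p q ξ i.succ = eP p q ξ i := by simp [εp, eP]

variable (p q) in
/-- The conjugated paravector basis `1, -e_1, …, -e_p`. -/
def εpBar : Fin (p + 1) → A := Fin.cons 1 fun i => -eP p q ξ i

theorem εpBar_zero : εpBar p q ξ 0 = 1 := rfl

theorem εpBar_succ (i : Fin p) : εpBar p q ξ i.succ = -eP p q ξ i := rfl

theorem εp_mul_εpBar (i j : Fin (p + 1)) :
    εp p q ξ i * εpBar p q ξ j + εp p q ξ j * εpBar p q ξ i = if i = j then 2 else 0 := by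
  cases i using Fin.cases <;> cases j using Fin.cases <;>
    simp only [εp_zero, εp_succ, εpBar_zero, εpBar_succ, Fin.succ_inj, Fin.succ_ne_zero,
      (Fin.succ_ne_zero _).symm, if_true, if_false, mul_one, one_mul, one_add_one_eq_two,
      neg_add_cancel, add_neg_cancel, mul_neg, ← neg_add, eP_mul_add_swap]
  split_ifs <;> simp

theorem εpBar_mul_εp (i j : Fin (p + 1)) :
    εpBar p q ξ i * εp p q ξ j + εpBar p q ξ j * εp p q ξ i = if i = j then 2 else 0 := by
  cases i using Fin.cases <;> cases j using Fin.cases <;>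
    simp only [εp_zero, εp_succ, εpBar_zero, εpBar_succ, Fin.succ_inj, Fin.succ_ne_zero,
      (Fin.succ_ne_zero _).symm, if_true, if_false, mul_one, one_mul, one_add_one_eq_two,
      neg_add_cancel, add_neg_cancel, neg_mul, ← neg_add, eP_mul_add_swap]
  split_ifs <;> simp

theorem ωCl_mul_self (v : Vq q) : ωCl p q ξ v * ωCl p q ξ v = -(‖v‖ ^ 2 • 1) := by
  have h1 : ωCl p q ξ v * ωCl p q ξ v =
      ∑ i, ∑ j, eQ p q ξ i * eQ p q ξ j * algebraMap ℝ A (v i * v j) := by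
    simp only [ωCl, Finset.sum_mul_sum, smul_mul_smul_comm, ← Algebra.commutes,
      ← Algebra.smul_def]
  rw [h1, sum_sum_mul_of_add_swap (s := -1) (fun i j => ?_) fun i j => by rw [mul_comm],
    EuclideanSpace.norm_sq_eq, Finset.sum_smul, ← Finset.sum_neg_distrib]
  · simp [Algebra.algebraMap_eq_smul_one, pow_two]
  · rw [eQ_mul_add_swap]
    split_ifs <;> norm_num

theorem eP_mul_ωCl (i : Fin p) (v : Vq q) :
    eP p q ξ i * ωCl p q ξ v = -(ωCl p q ξ v * eP p q ξ i) := by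
  simp only [ωCl, Finset.mul_sum, Finset.sum_mul, mul_smul_comm, smul_mul_assoc, eP_mul_eQ,
    smul_neg, Finset.sum_neg_distrib]

theorem εp_mul_ωCl (i : Fin (p + 1)) (v : Vq q) :
    εp p q ξ i * ωCl p q ξ v = ωCl p q ξ v * εpBar p q ξ i := by
  cases i using Fin.cases with
  | zero => simp [εp_zero, εpBar_zero]
  | succ i => rw [εp_succ, εpBar_succ, eP_mul_ωCl, mul_neg]

theorem εpBar_mul_ωCl (i : Fin (p + 1)) (v : Vq q) :
    εpBar p q ξ i * ωCl p q ξ v = ωCl p q ξ v * εp p q ξ i := by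
  cases i using Fin.cases with
  | zero => simp [εp_zero, εpBar_zero]
  | succ i => rw [εp_succ, εpBar_succ, neg_mul, eP_mul_ωCl, neg_neg]

theorem sum_eQ_mul_eQ : ∑ j, eQ p q ξ j * eQ p q ξ j = -(q : A) := by
  have h : ∀ j, eQ p q ξ j * eQ p q ξ j = -1 := fun j => by
    have h := eQ_mul_add_swap ξ j j
    rw [if_pos rfl, ← two_smul ℝ] at h
    refine smul_right_injective A (two_ne_zero (α := ℝ)) (h.trans ?_)
    simp only
    rw [smul_neg, two_smul, one_add_one_eq_two]
  simp [h]

theorem finiteDimensional_of_algEquiv_cl {n : ℕ} (ξ : A ≃ₐ[ℝ] Cl n) : FiniteDimensional ℝ A := by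
  have : FiniteDimensional ℝ (ExteriorAlgebra ℝ (Fin n → ℝ)) :=
    ((Pi.basisFun ℝ (Fin n)).ExteriorAlgebra).finiteDimensional_of_finite
  exact (ξ.toLinearEquiv.trans (CliffordAlgebra.equivExterior (Qe n))).symm.finiteDimensional

end CliffordRelations

end GPS

namespace GPS

section SliceAlgebra

variable {p q : ℕ} {W : Type*} [NormedAddCommGroup W] [NormedSpace ℝ W]
  {A : Type*} [NormedRing A] [NormedAlgebra ℝ A]
  {D : Set (Sl p)} {F G : Sl p → W}

theorem tendsto_mk_nhdsNE (x : Vp p) :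
    Tendsto (fun t : ℝ => ((x, t) : Sl p)) (𝓝[≠] 0) (𝓝 (x, 0)) :=
  ((by fun_prop : Continuous fun t : ℝ => ((x, t) : Sl p)).tendsto 0).mono_left
    nhdsWithin_le_nhds

theorem eqOn_of_smul_eq_smul (hD : IsOpen D) (hF : ContinuousOn F D) (hG : ContinuousOn G D)
    (h : ∀ z ∈ D, z.2 • F z = z.2 • G z) : EqOn F G D := by
  rintro ⟨x, r⟩ hz
  by_cases hr : r = 0
  · subst hr
    have ht := tendsto_mk_nhdsNE x
    refine tendsto_nhds_unique_of_eventuallyEq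
      ((hF.continuousAt (hD.mem_nhds hz)).tendsto.comp ht)
      ((hG.continuousAt (hD.mem_nhds hz)).tendsto.comp ht) ?_
    filter_upwards [ht (hD.mem_nhds hz), self_mem_nhdsWithin] with t htD ht0
    exact smul_right_injective W ht0 (h _ htD)
  · exact smul_right_injective W hr (h _ hz)

theorem SmoothEven.radT_eqOn [CompleteSpace W] (hD : IsOpen D) (hr : ReflInv p D)
    (hF : SmoothEven D F) (hG : ContinuousOn G D) (h : ∀ z ∈ D, z.2 • G z = GPS.pdr p F z) :
    EqOn (GPS.radT F) G D :=
  eqOn_of_smul_eq_smul hD (hF.radT hD hr).1.continuousOn hG fun z hz => by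
    rw [hF.smul_radT hD hr hz, h z hz]

theorem fderiv_eq_of_eqOn {E : Type*} [NormedAddCommGroup E] [NormedSpace ℝ E] {s : Set E}
    {f g : E → W} (hs : IsOpen s) (h : EqOn f g s) {z : E} (hz : z ∈ s) :
    fderiv ℝ f z = fderiv ℝ g z :=
  (h.eventuallyEq_of_mem (hs.mem_nhds hz)).fderiv_eq

theorem SmoothEven.differentiableAt (hD : IsOpen D) (hF : SmoothEven D F) {z : Sl p} (hz : z ∈ D) :
    DifferentiableAt ℝ F z :=
  (hF.1.contDiffAt (hD.mem_nhds hz)).differentiableAt (by simp)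

theorem SmoothEven.congr (hr : ReflInv p D) (hF : SmoothEven D F) (h : EqOn G F D) :
    SmoothEven D G :=
  ⟨hF.1.congr h, fun z hz => by rw [h hz, h (hr z hz), hF.2 z hz]⟩

theorem SmoothEven.add (hF : SmoothEven D F) (hG : SmoothEven D G) :
    SmoothEven D fun z => F z + G z :=
  ⟨hF.1.add hG.1, fun z hz => by simp only [hF.2 z hz, hG.2 z hz]⟩

theorem SmoothEven.const_smul (s : ℝ) (hF : SmoothEven D F) : SmoothEven D fun z => s • F z :=
  ⟨hF.1.const_smul s, fun z hz => by simp only [hF.2 z hz]⟩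

theorem SmoothEven.sq_smul (hF : SmoothEven D F) : SmoothEven D fun z => z.2 ^ 2 • F z :=
  ⟨(contDiff_snd.pow 2).contDiffOn.smul hF.1, fun z hz => by simp only [hF.2 z hz, neg_sq]⟩

theorem SmoothEven.const_mul {F : Sl p → A} (a : A) (hF : SmoothEven D F) :
    SmoothEven D fun z => a * F z :=
  ⟨contDiffOn_const.mul hF.1, fun z hz => by simp only [hF.2 z hz]⟩

theorem SmoothEven.sum {ι : Type*} {s : Finset ι} {F : ι → Sl p → W}
    (hF : ∀ i ∈ s, SmoothEven D (F i)) : SmoothEven D fun z => ∑ i ∈ s, F i z :=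
  ⟨ContDiffOn.sum fun i hi => (hF i hi).1,
    fun z hz => Finset.sum_congr rfl fun i hi => (hF i hi).2 z hz⟩

theorem fderiv_fderiv_comm {E : Type*} [NormedAddCommGroup E] [NormedSpace ℝ E] {s : Set E}
    {f : E → W} (hs : IsOpen s) (hf : ContDiffOn ℝ ∞ f s) {z : E} (hz : z ∈ s) (v w : E) :
    fderiv ℝ (fun y => fderiv ℝ f y v) z w = fderiv ℝ (fun y => fderiv ℝ f y w) z v := by
  have hf' := hf.contDiffAt (hs.mem_nhds hz)
  have hd : DifferentiableAt ℝ (fderiv ℝ f) z :=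
    (hf'.fderiv_right (m := ∞) (by simp)).differentiableAt (by simp)
  rw [fderiv_clm_apply hd (by fun_prop), fderiv_clm_apply hd (by fun_prop)]
  simpa using (hf'.isSymmSndFDerivAt (by simpa using (by exact_mod_cast le_top : ((2 : ℕ∞) : WithTop ℕ∞) ≤ ∞))) w v

theorem fderiv_snd_smul {z : Sl p} (hG : DifferentiableAt ℝ G z) (v : Vp p) :
    fderiv ℝ (fun z : Sl p => z.2 • G z) z (v, 0) = z.2 • fderiv ℝ G z (v, 0) := by
  rw [fderiv_fun_smul differentiableAt_snd hG]
  simp [fderiv_snd]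

theorem fderiv_sq_smul {z : Sl p} (hG : DifferentiableAt ℝ G z) (v : Vp p) (t : ℝ) :
    fderiv ℝ (fun z : Sl p => z.2 ^ 2 • G z) z (v, t) =
      z.2 ^ 2 • fderiv ℝ G z (v, t) + (2 * z.2 * t) • G z := by
  have h : HasFDerivAt (fun z : Sl p => z.2 ^ 2)
      ((2 * z.2) • ContinuousLinearMap.snd ℝ (Vp p) ℝ) z := by
    simpa using (hasFDerivAt_snd (𝕜 := ℝ) (p := z)).pow 2
  rw [(h.fun_smul hG.hasFDerivAt).fderiv]
  simp

theorem SmoothEven.pdr_fderiv_inl [CompleteSpace W] (hD : IsOpen D) (hr : ReflInv p D)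
    (hF : SmoothEven D F) {z : Sl p} (hz : z ∈ D) (v : Vp p) :
    GPS.pdr p (fun z => fderiv ℝ F z (v, 0)) z =
      z.2 • fderiv ℝ (GPS.radT F) z (v, 0) := by
  rw [GPS.pdr, fderiv_fderiv_comm hD hF.1 hz,
    ← fderiv_snd_smul ((hF.radT hD hr).differentiableAt hD hz)]
  congr 1
  exact (fderiv_eq_of_eqOn hD (fun y hy => hF.smul_radT hD hr hy) hz).symm

theorem SmoothEven.radT_sq_smul [CompleteSpace W] (hD : IsOpen D) (hr : ReflInv p D)
    (hF : SmoothEven D F) :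
    EqOn (GPS.radT fun z => z.2 ^ 2 • F z)
      (fun z => (2 : ℝ) • F z + z.2 ^ 2 • GPS.radT F z) D := by
  refine hF.sq_smul.radT_eqOn hD hr ((hF.const_smul 2).add (hF.radT hD hr).sq_smul).1.continuousOn
    fun z hz => ?_
  rw [GPS.pdr, fderiv_sq_smul (hF.differentiableAt hD hz)]
  change _ = z.2 ^ 2 • GPS.pdr p F z + _
  rw [← hF.smul_radT hD hr hz]
  module

theorem SmoothEven.radT_add [CompleteSpace W] (hD : IsOpen D) (hr : ReflInv p D)
    (hF : SmoothEven D F) (hG : SmoothEven D G) :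
    EqOn (GPS.radT fun z => F z + G z) (fun z => GPS.radT F z + GPS.radT G z) D := by
  refine (hF.add hG).radT_eqOn hD hr ((hF.radT hD hr).add (hG.radT hD hr)).1.continuousOn
    fun z hz => ?_
  rw [GPS.pdr, fderiv_fun_add (hF.differentiableAt hD hz) (hG.differentiableAt hD hz), smul_add,
    hF.smul_radT hD hr hz, hG.smul_radT hD hr hz]
  rfl

theorem SmoothEven.radT_const_smul [CompleteSpace W] (hD : IsOpen D) (hr : ReflInv p D)
    (hF : SmoothEven D F) (s : ℝ) :
    EqOn (GPS.radT fun z => s • F z) (fun z => s • GPS.radT F z) D := by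
  refine (hF.const_smul s).radT_eqOn hD hr ((hF.radT hD hr).const_smul s).1.continuousOn
    fun z hz => ?_
  rw [GPS.pdr, fderiv_fun_const_smul (hF.differentiableAt hD hz), smul_comm,
    hF.smul_radT hD hr hz]
  rfl

theorem SmoothEven.radT_congr [CompleteSpace W] (hD : IsOpen D) (hr : ReflInv p D)
    (hG : SmoothEven D G) (h : EqOn F G D) : EqOn (GPS.radT F) (GPS.radT G) D := by
  refine (hG.congr hr h).radT_eqOn hD hr (hG.radT hD hr).1.continuousOn fun z hz => ?_
  rw [hG.smul_radT hD hr hz, GPS.pdr, GPS.pdr, fderiv_eq_of_eqOn hD h hz]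

/-- The first-order operator `∑ a_i ∂_{x_i}` in the variables `𝐱_p`. -/
def gradMul (a : Fin (p + 1) → A) (F : Sl p → A) : Sl p → A :=
  fun z => ∑ i, a i * pdSl p i F z

section

variable {F G : Sl p → A} (a : Fin (p + 1) → A)

theorem SmoothEven.pdSl (hD : IsOpen D) (hr : ReflInv p D) (hF : SmoothEven D F)
    (i : Fin (p + 1)) : SmoothEven D (pdSl p i F) :=
  hF.fderiv_inl hD hr _

theorem SmoothEven.gradMul (hD : IsOpen D) (hr : ReflInv p D) (hF : SmoothEven D F) :
    SmoothEven D (gradMul a F) :=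
  SmoothEven.sum fun i _ => (hF.pdSl hD hr i).const_mul (a i)

theorem SmoothEven.radT_gradMul [CompleteSpace A] (hD : IsOpen D) (hr : ReflInv p D)
    (hF : SmoothEven D F) :
    EqOn (GPS.radT (GPS.gradMul a F)) (GPS.gradMul a (GPS.radT F)) D := by
  refine (hF.gradMul a hD hr).radT_eqOn hD hr ((hF.radT hD hr).gradMul a hD hr).1.continuousOn
    fun z hz => ?_
  have hd : ∀ i, DifferentiableAt ℝ (GPS.pdSl p i F) z := fun i =>
    (hF.pdSl hD hr i).differentiableAt hD hz
  unfold GPS.pdr GPS.gradMul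
  rw [fderiv_fun_sum fun i _ => (hd i).const_mul (a i), sum_apply,
    Finset.smul_sum]
  refine Finset.sum_congr rfl fun i _ => ?_
  rw [fderiv_const_mul (hd i)]
  have := hF.pdr_fderiv_inl hD hr hz (Pi.single i 1)
  change _ = a i * GPS.pdr p (GPS.pdSl p i F) z
  rw [← mul_smul_comm]
  exact congrArg (a i * ·) this.symm

theorem gradMul_congr (hD : IsOpen D) (h : EqOn F G D) :
    EqOn (gradMul a F) (gradMul a G) D := fun z hz => by
  simp only [gradMul, pdSl, fderiv_eq_of_eqOn hD h hz]

theorem SmoothEven.gradMul_add (hD : IsOpen D) (hF : SmoothEven D F) (hG : SmoothEven D G) :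
    EqOn (GPS.gradMul a fun z => F z + G z) (fun z => GPS.gradMul a F z + GPS.gradMul a G z) D :=
  fun z hz => by
    simp only [GPS.gradMul, GPS.pdSl, fderiv_fun_add (hF.differentiableAt hD hz)
      (hG.differentiableAt hD hz), add_apply, mul_add, Finset.sum_add_distrib]

theorem SmoothEven.gradMul_const_smul (hD : IsOpen D) (hF : SmoothEven D F) (s : ℝ) :
    EqOn (GPS.gradMul a fun z => s • F z) (fun z => s • GPS.gradMul a F z) D :=
  fun z hz => by
    simp only [GPS.gradMul, GPS.pdSl, fderiv_fun_const_smul (hF.differentiableAt hD hz),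
      smul_apply, mul_smul_comm, Finset.smul_sum]

theorem SmoothEven.gradMul_sq_smul (hD : IsOpen D) (hF : SmoothEven D F) :
    EqOn (GPS.gradMul a fun z => z.2 ^ 2 • F z) (fun z => z.2 ^ 2 • GPS.gradMul a F z) D :=
  fun z hz => by
    simp only [GPS.gradMul, GPS.pdSl, fderiv_sq_smul (hF.differentiableAt hD hz), mul_zero,
      zero_smul, add_zero, mul_smul_comm, Finset.smul_sum]

theorem SmoothEven.gradMul_gradMul (hD : IsOpen D) (hr : ReflInv p D) (hF : SmoothEven D F)
    {a c : Fin (p + 1) → A} (hac : ∀ i j, a i * c j + a j * c i = if i = j then 2 else 0) :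
    EqOn (GPS.gradMul a (GPS.gradMul c F)) (fun z => ∑ i, GPS.pdSl p i (GPS.pdSl p i F) z) D := by
  intro z hz
  have hd : ∀ i, DifferentiableAt ℝ (GPS.pdSl p i F) z := fun i =>
    (hF.pdSl hD hr i).differentiableAt hD hz
  have h : ∀ i, a i * GPS.pdSl p i (GPS.gradMul c F) z =
      ∑ j, a i * c j * GPS.pdSl p i (GPS.pdSl p j F) z := fun i => by
    change a i * fderiv ℝ (fun z => ∑ j, c j * GPS.pdSl p j F z) z _ = _
    rw [fderiv_fun_sum fun j _ => (hd j).const_mul (c j),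
      sum_apply, Finset.mul_sum]
    refine Finset.sum_congr rfl fun j _ => ?_
    rw [fderiv_const_mul (hd j), smul_apply, smul_eq_mul, mul_assoc]
    rfl
  rw [GPS.gradMul, Finset.sum_congr rfl fun i _ => h i,
    sum_sum_mul_of_add_swap (H := fun i j => GPS.pdSl p i (GPS.pdSl p j F) z) (s := 1) (by simpa using hac)
      fun i j => fderiv_fderiv_comm hD hF.1 hz _ _]
  simp

end

end SliceAlgebra

end GPS

namespace GPS

section Axial

variable {p q : ℕ} {A : Type*} [NormedRing A] [NormedAlgebra ℝ A] {ξ : A ≃ₐ[ℝ] Cl (p + q)}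
  {D : Set (Sl p)} {F G : Sl p → A} {k : ℕ}

variable (ξ) in
/-- Pairs `(F, G)` of smooth even functions with `D_{𝐱_p} F = (2k + 1) G + r ∂_r G` and
`\overline{D}_{𝐱_p} G = -(1/r) ∂_r F`. -/
structure IsVekuaPair (k : ℕ) (D : Set (Sl p)) (F G : Sl p → A) : Prop where
  left : SmoothEven D F
  right : SmoothEven D G
  gradMul_left : EqOn (gradMul (εp p q ξ) F)
    (fun z => (2 * k + 1 : ℝ) • G z + z.2 ^ 2 • radT G z) D
  gradMul_right : EqOn (gradMul (εpBar p q ξ) G) (fun z => (-1 : ℝ) • radT F z) D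

theorem IsVekuaPair.radT [CompleteSpace A] (hD : IsOpen D) (hr : ReflInv p D)
    (h : IsVekuaPair ξ k D F G) : IsVekuaPair ξ (k + 1) D (radT F) (radT G) where
  left := h.left.radT hD hr
  right := h.right.radT hD hr
  gradMul_left z hz := by
    have hG := h.right.radT hD hr
    rw [← h.left.radT_gradMul _ hD hr hz,
      SmoothEven.radT_congr hD hr ((h.right.const_smul _).add hG.sq_smul) h.gradMul_left hz,
      SmoothEven.radT_add hD hr (h.right.const_smul _) hG.sq_smul hz]
    simp only [h.right.radT_const_smul hD hr _ hz, hG.radT_sq_smul hD hr hz]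
    push_cast
    module
  gradMul_right z hz := by
    have hF := h.left.radT hD hr
    rw [← h.right.radT_gradMul _ hD hr hz,
      SmoothEven.radT_congr hD hr (hF.const_smul (-1)) h.gradMul_right hz,
      hF.radT_const_smul hD hr _ hz]

theorem IsVekuaPair.iterate_radT [CompleteSpace A] (hD : IsOpen D) (hr : ReflInv p D)
    (h : IsVekuaPair ξ 0 D F G) (k : ℕ) :
    IsVekuaPair ξ k D (GPS.radT^[k] F) (GPS.radT^[k] G) := by
  induction k with
  | zero => exact h
  | succ k ih =>
    rw [Function.iterate_succ_apply', Function.iterate_succ_apply']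
    exact ih.radT hD hr

theorem IsVekuaPair.sum_pdSl_left [CompleteSpace A] (hD : IsOpen D) (hr : ReflInv p D)
    (h : IsVekuaPair ξ k D F G) {z : Sl p} (hz : z ∈ D) :
    ∑ i, pdSl p i (pdSl p i F) z =
      -((2 * k + 1 : ℝ) • GPS.radT F z + z.2 ^ 2 • GPS.radT (GPS.radT F) z) := by
  have hG := h.right.radT hD hr
  refine (h.left.gradMul_gradMul hD hr (εpBar_mul_εp ξ) hz).symm.trans ?_
  rw [gradMul_congr _ hD h.gradMul_left hz,
    SmoothEven.gradMul_add _ hD (h.right.const_smul _) hG.sq_smul hz]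
  simp only [h.right.gradMul_const_smul _ hD _ hz, hG.gradMul_sq_smul _ hD hz,
    h.gradMul_right hz, (h.radT hD hr).gradMul_right hz]
  module

theorem IsVekuaPair.sum_pdSl_right [CompleteSpace A] (hD : IsOpen D) (hr : ReflInv p D)
    (h : IsVekuaPair ξ k D F G) {z : Sl p} (hz : z ∈ D) :
    ∑ i, pdSl p i (pdSl p i G) z =
      -((2 * k + 3 : ℝ) • GPS.radT G z + z.2 ^ 2 • GPS.radT (GPS.radT G) z) := by
  refine (h.right.gradMul_gradMul hD hr (εp_mul_εpBar ξ) hz).symm.trans ?_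
  rw [gradMul_congr _ hD h.gradMul_right hz,
    (h.left.radT hD hr).gradMul_const_smul _ hD _ hz]
  simp only [(h.radT hD hr).gradMul_left hz]
  push_cast
  module

variable (ξ) in
/-- The function `F(𝐱_p, |𝐱_q|) + 𝐱_q G(𝐱_p, |𝐱_q|)`. -/
def axialPair (F G : Sl p → A) : V p q → A := fun z => axial q F z + ωCl p q ξ z.2 * axial q G z

variable (p ξ) in
/-- The inclusion of `ℝ^q` into the Clifford algebra, as a continuous linear map. -/
def ωClL : Vq q →L[ℝ] A := ∑ j, (EuclideanSpace.proj j).smulRight (eQ p q ξ j)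

theorem ωClL_apply (v : Vq q) : ωClL p ξ v = ωCl p q ξ v := by
  simp [ωClL, ωCl, sum_apply]

theorem ωCl_smul (t : ℝ) (v : Vq q) : ωCl p q ξ (t • v) = t • ωCl p q ξ v := by
  simp only [← ωClL_apply, map_smul]

theorem ωCl_zero : ωCl p q ξ 0 = 0 := by
  simp only [← ωClL_apply, map_zero]

theorem ωCl_single (j : Fin q) : ωCl p q ξ (EuclideanSpace.single j 1) = eQ p q ξ j := by
  simp [ωCl, ite_smul]

theorem contDiff_ωCl_snd : ContDiff ℝ ∞ fun z : V p q => ωCl p q ξ z.2 := by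
  simp only [← ωClL_apply]
  exact (ωClL p ξ).contDiff.comp contDiff_snd

theorem contDiffOn_axialPair [CompleteSpace A] (hD : IsOpen D) (hr : ReflInv p D)
    (hF : SmoothEven D F) (hG : SmoothEven D G) :
    ContDiffOn ℝ ∞ (axialPair ξ F G) (cyl q D) :=
  (hF.contDiffOn_axial hD hr).add (contDiff_ωCl_snd.contDiffOn.mul (hG.contDiffOn_axial hD hr))

theorem SmoothEven.differentiableAt_axial (hD : IsOpen D) (hr : ReflInv p D)
    (hF : SmoothEven D F) {z : V p q} (hz : z ∈ cyl q D) :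
    DifferentiableAt ℝ (axial q F) z :=
  (hF.hasFDerivAt_axial hD hr hz).differentiableAt

theorem hasFDerivAt_ωCl_snd (z : V p q) : HasFDerivAt (fun z : V p q => ωCl p q ξ z.2)
    ((ωClL p ξ).comp (ContinuousLinearMap.snd ℝ (Vp p) (Vq q))) z := by
  simp only [← ωClL_apply]
  exact (ωClL p ξ).hasFDerivAt.comp z hasFDerivAt_snd

theorem differentiableAt_axialPair (hD : IsOpen D) (hr : ReflInv p D)
    (hF : SmoothEven D F) (hG : SmoothEven D G) {z : V p q} (hz : z ∈ cyl q D) :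
    DifferentiableAt ℝ (axialPair ξ F G) z :=
  (hF.differentiableAt_axial hD hr hz).add
    ((hasFDerivAt_ωCl_snd z).differentiableAt.mul (hG.differentiableAt_axial hD hr hz))

theorem fderiv_axialPair (hD : IsOpen D) (hr : ReflInv p D) (hF : SmoothEven D F)
    (hG : SmoothEven D G) {z : V p q} (hz : z ∈ cyl q D) (v : Vp p) (w : Vq q) :
    fderiv ℝ (axialPair ξ F G) z (v, w) =
      axialPair ξ (fun z => fderiv ℝ F z (v, 0)) (fun z => fderiv ℝ G z (v, 0)) z +
        ⟪z.2, w⟫ • axialPair ξ (GPS.radT F) (GPS.radT G) z + ωCl p q ξ w * axial q G z := by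
  have h1 := hF.differentiableAt_axial hD hr hz
  have h2 := hG.differentiableAt_axial hD hr hz
  have h3 := h1.hasFDerivAt.add ((hasFDerivAt_ωCl_snd (ξ := ξ) z).mul' h2.hasFDerivAt)
  have h4 : fderiv ℝ (axialPair ξ F G) z = _ := h3.fderiv
  rw [h4]
  simp only [add_apply, smul_apply, hF.fderiv_axial hD hr hz, hG.fderiv_axial hD hr hz,
    ContinuousLinearMap.comp_apply, ContinuousLinearMap.coe_snd', ωClL_apply, axialPair,
    smul_eq_mul, mul_add, smul_add, mul_smul_comm, MulOpposite.smul_eq_mul_unop,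
    MulOpposite.unop_op]
  abel

theorem inner_single_one (v : Vq q) (j : Fin q) : ⟪v, EuclideanSpace.single j 1⟫ = v j := by
  rw [EuclideanSpace.inner_single_right]
  simp

theorem pdV1_axialPair (hD : IsOpen D) (hr : ReflInv p D) (hF : SmoothEven D F)
    (hG : SmoothEven D G) (i : Fin (p + 1)) :
    EqOn (pdV1 p q i (axialPair ξ F G)) (axialPair ξ (pdSl p i F) (pdSl p i G)) (cyl q D) :=
  fun z hz => by
    rw [pdV1, fderiv_axialPair hD hr hF hG hz]
    simp only [ωCl_zero, inner_zero_right, zero_smul, zero_mul, add_zero]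
    rfl

theorem pdV2_axialPair (hD : IsOpen D) (hr : ReflInv p D) (hF : SmoothEven D F)
    (hG : SmoothEven D G) (j : Fin q) :
    EqOn (pdV2 p q j (axialPair ξ F G))
      (fun z => z.2 j • axialPair ξ (GPS.radT F) (GPS.radT G) z + eQ p q ξ j * axial q G z)
      (cyl q D) :=
  fun z hz => by
    have h : ((0, 0) : Sl p) = 0 := rfl
    rw [pdV2, fderiv_axialPair hD hr hF hG hz, ωCl_single, inner_single_one]
    simp [axialPair, axial, h]

theorem sum_smul_eQ (v : Vq q) : ∑ j, v j • eQ p q ξ j = ωCl p q ξ v := rfl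

theorem IsVekuaPair.lapV_axialPair [CompleteSpace A] (hD : IsOpen D) (hr : ReflInv p D)
    (h : IsVekuaPair ξ k D F G) :
    EqOn (LapV p q (axialPair ξ F G))
      (fun z => (q - 1 - 2 * k : ℝ) • axialPair ξ (GPS.radT F) (GPS.radT G) z) (cyl q D) := by
  intro z hz
  have hc : IsOpen (cyl q D) := isOpen_cyl hD
  have hF := h.left
  have hG := h.right
  have hTF := hF.radT hD hr
  have hTG := hG.radT hD hr
  have h1 : ∀ i, pdV1 p q i (pdV1 p q i (axialPair ξ F G)) z =
      axialPair ξ (pdSl p i (pdSl p i F)) (pdSl p i (pdSl p i G)) z := fun i => by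
    rw [pdV1, fderiv_eq_of_eqOn hc (pdV1_axialPair hD hr hF hG i) hz]
    exact pdV1_axialPair hD hr (hF.pdSl hD hr i) (hG.pdSl hD hr i) i hz
  have h2 : ∀ j, pdV2 p q j (pdV2 p q j (axialPair ξ F G)) z =
      axialPair ξ (GPS.radT F) (GPS.radT G) z +
      z.2 j ^ 2 • axialPair ξ (GPS.radT (GPS.radT F)) (GPS.radT (GPS.radT G)) z +
      (2 : ℝ) • ((z.2 j • eQ p q ξ j) * axial q (GPS.radT G) z) := fun j => by
    have hp : HasFDerivAt (fun z : V p q => z.2 j)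
        ((EuclideanSpace.proj j : Vq q →L[ℝ] ℝ).comp (ContinuousLinearMap.snd ℝ _ _)) z :=
      (EuclideanSpace.proj j : Vq q →L[ℝ] ℝ).hasFDerivAt.comp z hasFDerivAt_snd
    have hX := (differentiableAt_axialPair (ξ := ξ) hD hr hTF hTG hz)
    have hY := hG.differentiableAt_axial hD hr hz
    have h3 := pdV2_axialPair (ξ := ξ) hD hr hTF hTG j hz
    have h4 : fderiv ℝ (axial q G) z (0, EuclideanSpace.single j 1) =
        z.2 j • axial q (GPS.radT G) z := by
      have h5 : ((0, 0) : Sl p) = 0 := rfl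
      rw [hG.fderiv_axial hD hr hz, inner_single_one]
      simp [axial, h5]
    rw [pdV2, fderiv_eq_of_eqOn hc (pdV2_axialPair hD hr hF hG j) hz,
      ((hp.fun_smul hX.hasFDerivAt).fun_add (hY.hasFDerivAt.const_mul (eQ p q ξ j))).fderiv]
    simp only [add_apply, smul_apply, ContinuousLinearMap.smulRight_apply,
      ContinuousLinearMap.comp_apply, ContinuousLinearMap.coe_snd', PiLp.proj_apply, h4]
    change z.2 j • pdV2 p q j (axialPair ξ (GPS.radT F) (GPS.radT G)) z + _ + _ = _
    rw [h3]
    simp only [smul_mul_assoc, smul_eq_mul, mul_smul_comm]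
    simp
    module
  have h3 := h.sum_pdSl_left hD hr hz
  have h4 := h.sum_pdSl_right hD hr hz
  rw [LapV, Finset.sum_congr rfl fun i _ => h1 i, Finset.sum_congr rfl fun j _ => h2 j]
  simp only [axialPair, axial, Finset.sum_add_distrib, ← Finset.mul_sum, ← Finset.smul_sum,
    ← Finset.sum_mul, sum_smul_eQ, ← Finset.sum_smul, ← EuclideanSpace.real_norm_sq_eq, h3, h4,
    Finset.sum_const, Finset.card_univ, Fintype.card_fin, mul_neg, mul_add, mul_smul_comm,
    ← Nat.cast_smul_eq_nsmul ℝ, smul_add]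
  module

theorem IsVekuaPair.dV_axialPair (hD : IsOpen D) (hr : ReflInv p D)
    (h : IsVekuaPair ξ k D F G) (hk : 2 * k + 1 = q) {z : V p q} (hz : z ∈ cyl q D) :
    DV p q ξ (axialPair ξ F G) z = 0 := by
  have h1 := h.gradMul_left hz
  have h2 := h.gradMul_right hz
  have hq : (2 * k + 1 : ℝ) = q := by exact_mod_cast hk
  simp only [gradMul] at h1 h2
  have h3 : ∀ i, εp p q ξ i * pdV1 p q i (axialPair ξ F G) z =
      εp p q ξ i * pdSl p i F (z.1, ‖z.2‖) +
        ωCl p q ξ z.2 * (εpBar p q ξ i * pdSl p i G (z.1, ‖z.2‖)) := fun i => by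
    rw [pdV1_axialPair hD hr h.left h.right i hz, axialPair, mul_add, ← mul_assoc, εp_mul_ωCl,
      mul_assoc]
    rfl
  have h4 : ∀ j, eQ p q ξ j * pdV2 p q j (axialPair ξ F G) z =
      z.2 j • eQ p q ξ j * axialPair ξ (GPS.radT F) (GPS.radT G) z +
        eQ p q ξ j * eQ p q ξ j * G (z.1, ‖z.2‖) := fun j => by
    rw [pdV2_axialPair hD hr h.left h.right j hz, mul_add, mul_smul_comm, ← smul_mul_assoc,
      ← mul_assoc]
    rfl
  rw [DV, Finset.sum_congr rfl fun i _ => h3 i, Finset.sum_congr rfl fun j _ => h4 j]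
  simp only [Finset.sum_add_distrib, ← Finset.mul_sum, ← Finset.sum_mul, sum_smul_eQ,
    sum_eQ_mul_eQ, h1, h2, axialPair, axial, mul_add]
  rw [← mul_assoc (ωCl p q ξ z.2) (ωCl p q ξ z.2), ωCl_mul_self, hq, mul_smul_comm, neg_mul,
    smul_mul_assoc, one_mul, neg_mul, ← nsmul_eq_mul, ← Nat.cast_smul_eq_nsmul ℝ]
  module

end Axial

end GPS

namespace GPS

section FueterSce

variable {p q : ℕ} {A : Type*} [NormedRing A] [NormedAlgebra ℝ A] {ξ : A ≃ₐ[ℝ] Cl (p + q)}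
  {D : Set (Sl p)} {F F1 F2 : Sl p → A}

theorem mem_S_iff {v : Vq q} : v ∈ S q ↔ ‖v‖ = 1 := by
  change ∑ j, v j ^ 2 = 1 ↔ _
  rw [← EuclideanSpace.real_norm_sq_eq, pow_eq_one_iff_of_nonneg (norm_nonneg v) two_ne_zero]

theorem exists_mem_S_smul_eq (hq : 0 < q) (y : Vq q) : ∃ v ∈ S q, ‖y‖ • v = y := by
  by_cases hy : y = 0
  · exact ⟨EuclideanSpace.single ⟨0, hq⟩ 1, mem_S_iff.2 (by simp), by simp [hy]⟩
  · exact ⟨‖y‖⁻¹ • y, mem_S_iff.2 (norm_smul_inv_norm (𝕜 := ℝ) hy), by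
      rw [smul_smul, mul_inv_cancel₀ (norm_ne_zero_iff.2 hy), one_smul]⟩

theorem ReflInv.abs_mem (hr : ReflInv p D) {z : Sl p} (hz : z ∈ D) : ((z.1, |z.2|) : Sl p) ∈ D := by
  rcases abs_choice z.2 with h | h
  · rwa [h]
  · rw [h]; exact hr z hz

theorem norm_smul_of_mem_S {v : Vq q} (hv : v ∈ S q) (t : ℝ) : ‖t • v‖ = |t| := by
  rw [norm_smul, mem_S_iff.1 hv, mul_one, Real.norm_eq_abs]

theorem spt_mem_cyl (hr : ReflInv p D) {z : Sl p} (hz : z ∈ D) {v : Vq q} (hv : v ∈ S q) :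
    spt p q v z ∈ cyl q D := by
  change ((z.1, ‖z.2 • v‖) : Sl p) ∈ D
  rw [norm_smul_of_mem_S hv]
  exact hr.abs_mem hz

theorem completion_eq_cyl (hq : 0 < q) (hr : ReflInv p D) : completion p q D = cyl q D := by
  ext ⟨x, y⟩
  constructor
  · rintro ⟨z, hz, v, hv, h⟩
    rw [h]
    exact spt_mem_cyl hr hz hv
  · intro h
    obtain ⟨v, hv, hvy⟩ := exists_mem_S_smul_eq hq y
    exact ⟨(x, ‖y‖), h, v, hv, by simp [spt, hvy]⟩

theorem SmoothEven.apply_abs (hF : SmoothEven D F) {z : Sl p} (hz : z ∈ D) :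
    F (z.1, |z.2|) = F z := by
  rcases abs_choice z.2 with h | h
  · rw [h]
  · rw [h]; exact hF.2 z hz

theorem SmoothEven.axialPair_spt {G : Sl p → A} (hF : SmoothEven D F) (hG : SmoothEven D G)
    {z : Sl p} (hz : z ∈ D) {v : Vq q} (hv : v ∈ S q) :
    axialPair ξ F G (spt p q v z) = F z + ωCl p q ξ v * (z.2 • G z) := by
  simp only [axialPair, axial, spt, norm_smul_of_mem_S hv, hF.apply_abs hz, hG.apply_abs hz,
    ωCl_smul, smul_mul_assoc, mul_smul_comm]

theorem gradMul_εpBar (F : Sl p → A) : gradMul (εpBar p q ξ) F = DPbar p q ξ F := by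
  funext z
  simp [gradMul, DPbar, Fin.sum_univ_succ, εpBar_zero, εpBar_succ, sub_eq_add_neg]

theorem gradMul_εp (F : Sl p → A) : gradMul (εp p q ξ) F = DP p q ξ F := rfl

theorem CRSystem.contDiffOn_add_mul [CompleteSpace A] (hD : IsOpen D) (h1 : ContDiffOn ℝ 1 F1 D)
    (h2 : ContDiffOn ℝ 1 F2 D) (h : CRSystem p q ξ D F1 F2) {v : Vq q} (hv : v ∈ S q) :
    ContDiffOn ℝ ∞ (fun z => F1 z + ωCl p q ξ v * F2 z) D := by
  have hv2 : ωCl p q ξ v * ωCl p q ξ v = -1 := by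
    rw [ωCl_mul_self, mem_S_iff.1 hv]; simp
  refine contDiffOn_of_dirac ((Pi.basisFun ℝ (Fin (p + 1))).prod (Module.Basis.singleton Unit ℝ))
    (a := Sum.elim (εp p q ξ) fun _ => ωCl p q ξ v)
    (c := Sum.elim (εpBar p q ξ) fun _ => -ωCl p q ξ v) ?_ hD
    (h1.add (contDiffOn_const.mul h2)) fun z hz => ?_
  · rintro (i | i) (j | j)
    · simpa using εpBar_mul_εp ξ i j
    · simp [εpBar_mul_ωCl]
    · simp [εpBar_mul_ωCl]
    · simp [hv2, one_add_one_eq_two]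
  · have hd1 : DifferentiableAt ℝ F1 z :=
      (h1.contDiffAt (hD.mem_nhds hz)).differentiableAt (by simp)
    have hd2 : DifferentiableAt ℝ F2 z :=
      (h2.contDiffAt (hD.mem_nhds hz)).differentiableAt (by simp)
    obtain ⟨e1, e2⟩ := h z hz
    rw [← gradMul_εpBar] at e2
    have e3 : ∀ w, fderiv ℝ (fun z => F1 z + ωCl p q ξ v * F2 z) z w =
        fderiv ℝ F1 z w + ωCl p q ξ v * fderiv ℝ F2 z w := fun w => by
      rw [fderiv_fun_add hd1 (hd2.const_mul _), fderiv_const_mul hd2]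
      rfl
    simp only [e3, Fintype.sum_sum_type, Sum.elim_inl, Sum.elim_inr, Module.Basis.prod_apply,
      Function.comp, Pi.basisFun_apply, Module.Basis.singleton_apply, LinearMap.inl_apply,
      LinearMap.inr_apply, Finset.univ_unique, Finset.sum_singleton, mul_add,
      Finset.sum_add_distrib, ← mul_assoc, εp_mul_ωCl, hv2]
    simp only [mul_assoc (ωCl p q ξ v), ← Finset.mul_sum]
    change DP p q ξ F1 z + ωCl p q ξ v * pdr p F1 z +
      (ωCl p q ξ v * gradMul (εpBar p q ξ) F2 z + -1 * pdr p F2 z) = 0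
    rw [eq_neg_of_add_eq_zero_left e2, sub_eq_zero.1 e1]
    noncomm_ring

theorem CRSystem.contDiffOn_infty [CompleteSpace A] (hq : 0 < q) (hD : IsOpen D)
    (h1 : ContDiffOn ℝ 1 F1 D) (h2 : ContDiffOn ℝ 1 F2 D) (h : CRSystem p q ξ D F1 F2) :
    ContDiffOn ℝ ∞ F1 D ∧ ContDiffOn ℝ ∞ F2 D := by
  obtain ⟨v, hv, -⟩ := exists_mem_S_smul_eq hq 0
  have hv2 : ωCl p q ξ v * ωCl p q ξ v = -1 := by
    rw [ωCl_mul_self, mem_S_iff.1 hv]; simp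
  have hv' : -v ∈ S q := mem_S_iff.2 (by rw [norm_neg, mem_S_iff.1 hv])
  have hn : ωCl p q ξ (-v) = -ωCl p q ξ v := by simp only [← ωClL_apply, map_neg]
  have hs := h.contDiffOn_add_mul hD h1 h2 hv
  have ht := h.contDiffOn_add_mul hD h1 h2 hv'
  rw [hn] at ht
  have e1 : F1 = fun z => (2⁻¹ : ℝ) • ((F1 z + ωCl p q ξ v * F2 z) +
      (F1 z + -ωCl p q ξ v * F2 z)) := by
    funext z
    rw [neg_mul]
    module
  have e2 : F2 = fun z => -ωCl p q ξ v * ((2⁻¹ : ℝ) • ((F1 z + ωCl p q ξ v * F2 z) -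
      (F1 z + -ωCl p q ξ v * F2 z))) := by
    funext z
    have : (2⁻¹ : ℝ) • ((F1 z + ωCl p q ξ v * F2 z) - (F1 z + -ωCl p q ξ v * F2 z)) =
        ωCl p q ξ v * F2 z := by
      rw [neg_mul]
      module
    rw [this, neg_mul, ← mul_assoc, hv2, neg_one_mul, neg_neg]
  constructor
  · rw [e1]
    exact (hs.add ht).const_smul _
  · rw [e2]
    exact contDiffOn_const.mul ((hs.sub ht).const_smul _)

theorem CRSystem.isVekuaPair [CompleteSpace A] (hD : IsOpen D) (hr : ReflInv p D)
    (h1 : SmoothEven D F1) (h2 : SmoothOdd D F2) (h : CRSystem p q ξ D F1 F2) :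
    IsVekuaPair ξ 0 D F1 (divR F2) where
  left := h1
  right := h2.divR hD
  gradMul_left z hz := by
    have hG := h2.divR hD
    have e : pdr p F2 z = fderiv ℝ (fun z : Sl p => z.2 • divR F2 z) z (0, 1) := by
      rw [pdr, fderiv_eq_of_eqOn hD (fun y hy => h2.smul_divR hy) hz]
    rw [gradMul_εp, sub_eq_zero.1 (h z hz).1, e,
      fderiv_fun_smul differentiableAt_snd (hG.differentiableAt hD hz)]
    have e2 : fderiv ℝ (divR F2) z (0, 1) = z.2 • radT (divR F2) z := (hG.smul_radT hD hr hz).symm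
    simp only [add_apply, smul_apply, ContinuousLinearMap.smulRight_apply, fderiv_snd,
      ContinuousLinearMap.coe_snd', e2, CharP.cast_eq_zero]
    module
  gradMul_right := by
    have hG := h2.divR hD
    refine eqOn_of_smul_eq_smul hD (hG.gradMul _ hD hr).1.continuousOn
      ((h1.radT hD hr).const_smul (-1)).1.continuousOn fun z hz => ?_
    have e : z.2 • gradMul (εpBar p q ξ) (divR F2) z =
        gradMul (εpBar p q ξ) (fun z => z.2 • divR F2 z) z := by
      simp only [gradMul, pdSl, fderiv_snd_smul (hG.differentiableAt hD hz), mul_smul_comm,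
        Finset.smul_sum]
    rw [e, gradMul_congr _ hD (fun y hy => h2.smul_divR hy) hz, gradMul_εpBar,
      eq_neg_of_add_eq_zero_left (h z hz).2, smul_comm, h1.smul_radT hD hr hz, neg_one_smul]

theorem lapV_congr {W : Type*} [NormedAddCommGroup W] [NormedSpace ℝ W] {U : Set (V p q)}
    (hU : IsOpen U) {f g : V p q → W} (h : EqOn f g U) :
    EqOn (LapV p q f) (LapV p q g) U := by
  have h1 : ∀ i, EqOn (pdV1 p q i f) (pdV1 p q i g) U := fun i z hz => by
    rw [pdV1, pdV1, fderiv_eq_of_eqOn hU h hz]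
  have h2 : ∀ j, EqOn (pdV2 p q j f) (pdV2 p q j g) U := fun j z hz => by
    rw [pdV2, pdV2, fderiv_eq_of_eqOn hU h hz]
  intro z hz
  rw [LapV, LapV]
  congr 1
  · refine Finset.sum_congr rfl fun i _ => ?_
    rw [pdV1, pdV1, fderiv_eq_of_eqOn hU (h1 i) hz]
  · refine Finset.sum_congr rfl fun j _ => ?_
    rw [pdV2, pdV2, fderiv_eq_of_eqOn hU (h2 j) hz]

theorem lapV_const_smul {W : Type*} [NormedAddCommGroup W] [NormedSpace ℝ W] (c : ℝ)
    (f : V p q → W) : LapV p q (fun z => c • f z) = fun z => c • LapV p q f z := by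
  have h1 : ∀ i (f : V p q → W), pdV1 p q i (fun z => c • f z) = fun z => c • pdV1 p q i f z :=
    fun i f => by
      funext z
      exact congrArg (fun L : V p q →L[ℝ] W => L (Pi.single i 1, 0)) (congrFun (fderiv_const_smul_field (f := f) c) z)
  have h2 : ∀ j (f : V p q → W), pdV2 p q j (fun z => c • f z) = fun z => c • pdV2 p q j f z :=
    fun j f => by
      funext z
      exact congrArg (fun L : V p q →L[ℝ] W => L (0, EuclideanSpace.single j 1))
        (congrFun (fderiv_const_smul_field (f := f) c) z)
  funext z
  simp only [LapV, h1, h2, smul_add, Finset.smul_sum]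

theorem IsVekuaPair.iterate_lapV [CompleteSpace A] {G : Sl p → A} (hD : IsOpen D)
    (hr : ReflInv p D) (h : IsVekuaPair ξ 0 D F G) {f : V p q → A}
    (hf : EqOn f (axialPair ξ F G) (cyl q D)) (k : ℕ) :
    EqOn ((LapV p q)^[k] f) (fun z => (∏ j ∈ Finset.range k, (q - 1 - 2 * j : ℝ)) •
      axialPair ξ (GPS.radT^[k] F) (GPS.radT^[k] G) z) (cyl q D) := by
  induction k with
  | zero => simpa using hf
  | succ k ih =>
    intro z hz
    simp only [Function.iterate_succ_apply']
    rw [lapV_congr (isOpen_cyl hD) ih hz, lapV_const_smul]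
    simp only [(h.iterate_radT hD hr k).lapV_axialPair hD hr hz]
    rw [smul_smul, Finset.prod_range_succ]

theorem prod_range_sub_eq_doubleFactorial (n : ℕ) :
    ∏ j ∈ Finset.range n, (2 * n - 2 * j : ℝ) = ((2 * n)‼ : ℝ) := by
  induction n with
  | zero => simp
  | succ n ih =>
    rw [Finset.prod_range_succ', mul_add, Nat.doubleFactorial_add_two, Nat.cast_mul, ← ih, mul_comm]
    congr 1
    · push_cast
      ring
    · refine Finset.prod_congr rfl fun j _ => ?_
      push_cast
      ring

theorem aIter_eqOn (hD : IsOpen D) (F : Sl p → A) (k : ℕ) :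
    EqOn (AIter p F k) (radT^[k] F) (D ∩ {z | z.2 ≠ 0}) := by
  have hO : IsOpen (D ∩ {z : Sl p | z.2 ≠ 0}) := hD.inter (isOpen_ne.preimage continuous_snd)
  induction k with
  | zero => exact fun _ _ => rfl
  | succ k ih =>
    intro z hz
    have h0 : z.2 ≠ 0 := hz.2
    rw [Function.iterate_succ_apply']
    change z.2⁻¹ • fderiv ℝ (AIter p F k) z (0, 1) = _
    rw [fderiv_eq_of_eqOn hO ih hz]
    simp [radT, divR, h0, pdr]

theorem IsVekuaPair.bIter_eqOn [CompleteSpace A] (hD : IsOpen D) (hr : ReflInv p D)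
    (h : IsVekuaPair ξ 0 D F (divR F2)) (h2 : SmoothOdd D F2) (k : ℕ) :
    EqOn (BIter p F2 k) (fun z => z.2 • GPS.radT^[k] (divR F2) z) (D ∩ {z | z.2 ≠ 0}) := by
  have hO : IsOpen (D ∩ {z : Sl p | z.2 ≠ 0}) := hD.inter (isOpen_ne.preimage continuous_snd)
  induction k with
  | zero => exact fun z hz => (h2.smul_divR hz.1).symm
  | succ k ih =>
    intro z hz
    have e : EqOn (fun w : Sl p => w.2⁻¹ • BIter p F2 k w) (GPS.radT^[k] (divR F2))
        (D ∩ {z | z.2 ≠ 0}) := fun w hw => by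
      have h0 : w.2 ≠ 0 := hw.2
      simp only [ih hw, smul_smul, inv_mul_cancel₀ h0, one_smul]
    simp only [Function.iterate_succ_apply']
    change fderiv ℝ (fun w : Sl p => w.2⁻¹ • BIter p F2 k w) z (0, 1) = _
    rw [fderiv_eq_of_eqOn hO e hz]
    exact ((h.iterate_radT hD hr k).right.smul_radT hD hr hz.1).symm

end FueterSce

end GPS

end AuxiliaryResults

/-- **Fueter–Sce theorem for generalized partial-slice monogenic functions**
(Theorem 3.9).  Let `f = F₁ + ωF₂ ∈ 𝒢𝒮ℛ(Ω_D)` and let `q` be odd.  Then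
`τ_q f = (1/(q−1)!!) Δ_𝐱^{(q−1)/2} f = A + ωB`, where
`A = ((1/r)∂_r)^{(q−1)/2} F₁`, `B = (∂_r(1/r))^{(q−1)/2} F₂` (values at `r = 0`
taken as limits), is monogenic in `Ω_D`; in particular `τ_q` maps `𝒢𝒮ℛ(Ω_D)` into
the axially monogenic class `𝒜ℳ(Ω_D) = ℳ(Ω_D) ∩ 𝒢𝒮(Ω_D)`. -/
theorem fueter_sce
    (p q : ℕ) (hq : Odd q) {A : Type*} [NormedRing A] [NormedAlgebra ℝ A]
    (ξ : A ≃ₐ[ℝ] Cl (p + q))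
    (D : Set (Sl p)) (hD : IsDomain D) (hrefl : ReflInv p D)
    (f : V p q → A) (F1 F2 : Sl p → A)
    (hgsr : GSROnWith p q ξ D f F1 F2) :
    ∃ AA BB : Sl p → A,
      (∀ z ∈ D, z.2 ≠ 0 →
        AA z = AIter p F1 ((q - 1) / 2) z ∧ BB z = BIter p F2 ((q - 1) / 2) z) ∧
      (∀ x : Vp p, ((x, 0) : Sl p) ∈ D →
        Tendsto (fun t : ℝ => AIter p F1 ((q - 1) / 2) (x, t)) (𝓝[≠] 0)
          (𝓝 (AA (x, 0))) ∧
        Tendsto (fun t : ℝ => BIter p F2 ((q - 1) / 2) (x, t)) (𝓝[≠] 0)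
          (𝓝 (BB (x, 0)))) ∧
      (∀ z ∈ D, ∀ v ∈ S q,
        tauq p q f (spt p q v z) = AA z + ωCl p q ξ v * BB z) ∧
      MonogenicOn p q ξ (completion p q D) (tauq p q f) ∧
      IsGPSlice p q ξ D (tauq p q f) AA BB := by
  obtain ⟨N, rfl⟩ := hq
  have hN : (2 * N + 1 - 1) / 2 = N := by omega
  have hq : 0 < 2 * N + 1 := Nat.succ_pos _
  have : FiniteDimensional ℝ A := finiteDimensional_of_algEquiv_cl ξ
  have : CompleteSpace A := FiniteDimensional.complete ℝ A
  obtain ⟨hO, -⟩ := hD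
  obtain ⟨⟨hpar, hf⟩, h1, h2, hCR⟩ := hgsr
  obtain ⟨h1', h2'⟩ := hCR.contDiffOn_infty hq hO h1 h2
  have hF1 : SmoothEven D F1 := ⟨h1', fun z hz => (hpar z hz).1⟩
  have hF2 : SmoothOdd D F2 := ⟨h2', fun z hz => (hpar z hz).2⟩
  have hP := hCR.isVekuaPair hO hrefl hF1 hF2
  have hPN := hP.iterate_radT hO hrefl N
  have hfe : Set.EqOn f (axialPair ξ F1 (divR F2)) (cyl (2 * N + 1) D) := by
    rintro ⟨x, y⟩ hz
    obtain ⟨v, hv, hvy⟩ := exists_mem_S_smul_eq hq y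
    have hs : ((x, y) : V p (2 * N + 1)) = spt p (2 * N + 1) v (x, ‖y‖) := by simp [spt, hvy]
    have hz' : ((x, ‖y‖) : Sl p) ∈ D := hz
    rw [hs, hf _ hz' v hv, hF1.axialPair_spt hP.right hz' hv, hF2.smul_divR hz']
  have htau : Set.EqOn (tauq p (2 * N + 1) f) (axialPair ξ (radT^[N] F1) (radT^[N] (divR F2)))
      (cyl (2 * N + 1) D) := by
    intro z hz
    have hc : ∏ j ∈ Finset.range N, (((2 * N + 1 : ℕ) : ℝ) - 1 - 2 * j) = ((2 * N)‼ : ℝ) := by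
      rw [← prod_range_sub_eq_doubleFactorial]
      refine Finset.prod_congr rfl fun j _ => ?_
      push_cast
      ring
    have h0 : ((2 * N)‼ : ℝ) ≠ 0 := by exact_mod_cast (Nat.doubleFactorial_pos _).ne'
    rw [tauq, hN, hP.iterate_lapV hO hrefl hfe N hz, hc, Nat.add_sub_cancel, smul_smul,
      inv_mul_cancel₀ h0, one_smul]
  have htau' : ∀ z ∈ D, ∀ v ∈ S (2 * N + 1), tauq p (2 * N + 1) f (spt p (2 * N + 1) v z) =
      radT^[N] F1 z + ωCl p (2 * N + 1) ξ v * (z.2 • radT^[N] (divR F2) z) := fun z hz v hv => by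
    rw [htau (spt_mem_cyl hrefl hz hv), hPN.left.axialPair_spt hPN.right hz hv]
  have hBB : ContinuousOn (fun z : Sl p => z.2 • radT^[N] (divR F2) z) D :=
    continuous_snd.continuousOn.smul hPN.right.1.continuousOn
  have hA := aIter_eqOn hO F1 N
  have hB := hP.bIter_eqOn hO hrefl hF2 N
  rw [hN]
  refine ⟨radT^[N] F1, fun z => z.2 • radT^[N] (divR F2) z, fun z hz h0 =>
    ⟨(hA ⟨hz, h0⟩).symm, (hB ⟨hz, h0⟩).symm⟩, fun x hx => ?_, htau', ?_, fun z hz => ?_, htau'⟩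
  · have ht := tendsto_mk_nhdsNE x
    have hev : ∀ᶠ t : ℝ in 𝓝[≠] 0, ((x, t) : Sl p) ∈ D ∩ {z | z.2 ≠ 0} := by
      filter_upwards [ht (hO.mem_nhds hx), self_mem_nhdsWithin] with t h h' using ⟨h, h'⟩
    exact ⟨((hPN.left.1.continuousOn.continuousAt (hO.mem_nhds hx)).tendsto.comp ht).congr'
        (hev.mono fun t h => (hA h).symm),
      ((hBB.continuousAt (hO.mem_nhds hx)).tendsto.comp ht).congr'
        (hev.mono fun t h => (hB h).symm)⟩
  · rw [completion_eq_cyl hq hrefl]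
    refine ⟨((contDiffOn_axialPair hO hrefl hPN.left hPN.right).of_le (by simp)).congr htau,
      fun z hz => ?_⟩
    have hd : fderiv ℝ (tauq p (2 * N + 1) f) z = _ := fderiv_eq_of_eqOn (isOpen_cyl hO) htau hz
    rw [← hPN.dV_axialPair hO hrefl rfl hz]
    simp only [DV, pdV1, pdV2, hd]
  · exact ⟨hPN.left.2 z hz, by simp only [hPN.right.2 z hz, neg_smul]⟩
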